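/- arXiv:2603.29124 — 2 statements merged into one kernel-verified Lean document; each statement's English description precedes it below -/
import Mathlib

section
/- Suppose Assumptions A1 and A2 hold, (1−q)/2 ≤ 2q + s < 1 − q, 4q + s + p − 2 < 0, and (1−q)/2 < p < 2q + s. Let (x,λ) be a global solution of the dynamical system, let (x_t,λ_t) be the unique saddle point of L_t with t ↦ (x_t,λ_t) continuously differentiable, and let (x*,λ*) be the projection of the origin onto Ω. Then, as t → +∞: L(x(t),λ*) − L(x*,λ*) = O(√(m(t)) t^{(4q+s+p−2)/2} + t^{−p}), |f(x(t)) − f(x*)| = O(√(m(t)) t^{(4q+s+p−2)/2} + t^{−p}), ‖Ax(t) − b‖ = O(√(m(t)) t^{(4q+s+p−2)/2} + t^{−p}), and ‖(x(t)−x_t, λ(t)−λ_t)‖² = O(m(t) t^{4q+s+p−2}). -/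
open Real Filter Asymptotics
open scoped RealInnerProductSpace Topology

lemma HasGradientAt.comp_hasDerivAt_inner {X : Type*} [NormedAddCommGroup X]
    [InnerProductSpace ℝ X] [CompleteSpace X] {f : X → ℝ} {g x' : X} {x : ℝ → X} {t : ℝ}
    (hf : HasGradientAt f g (x t)) (hx : HasDerivAt x x' t) :
    HasDerivAt (fun τ => f (x τ)) ⟪g, x'⟫ t := by
  have h := hf.hasFDerivAt.comp_hasDerivAt t hx
  rw [InnerProductSpace.toDual_apply_apply] at h
  exact h

/-- The gradient inequality for a differentiable convex function on a Hilbert space. -/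
lemma ConvexOn.add_inner_gradient_le {X : Type*} [NormedAddCommGroup X] [InnerProductSpace ℝ X]
    [CompleteSpace X] {f : X → ℝ} {g u : X} (hconv : ConvexOn ℝ Set.univ f)
    (hf : HasGradientAt f g u) (v : X) : f u + ⟪g, v - u⟫ ≤ f v := by
  have hline : ConvexOn ℝ Set.univ (fun r : ℝ => f (AffineMap.lineMap u v r)) := by
    have h := hconv.comp_affineMap (AffineMap.lineMap u v : ℝ →ᵃ[ℝ] X)
    rw [Set.preimage_univ] at h
    exact h
  have hd : HasDerivAt (fun r : ℝ => f (AffineMap.lineMap u v r)) ⟪g, v - u⟫ 0 := by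
    have h1 : HasDerivAt (fun r : ℝ => (AffineMap.lineMap u v r : X)) (v - u) 0 :=
      AffineMap.hasDerivAt_lineMap
    have h2 : HasGradientAt f g (AffineMap.lineMap u v (0 : ℝ)) := by
      simpa using hf
    exact h2.comp_hasDerivAt_inner h1
  have := hline.le_slope_of_hasDerivAt (Set.mem_univ 0) (Set.mem_univ 1) one_pos hd
  simp [slope_def_field] at this
  linarith

lemma ConvexOn.inner_gradient_sub_nonneg {X : Type*} [NormedAddCommGroup X]
    [InnerProductSpace ℝ X] [CompleteSpace X] {f : X → ℝ} {f' : X → X}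
    (hconv : ConvexOn ℝ Set.univ f) (hf : ∀ u, HasGradientAt f (f' u) u) (u v : X) :
    0 ≤ ⟪f' u - f' v, u - v⟫ := by
  have h1 := hconv.add_inner_gradient_le (hf u) v
  have h2 := hconv.add_inner_gradient_le (hf v) u
  have h3 : ⟪f' u, v - u⟫ = -⟪f' u, u - v⟫ := by rw [← inner_neg_right, neg_sub]
  rw [inner_sub_left]
  linarith

section SaddlePath

variable {X Y : Type*} [NormedAddCommGroup X] [InnerProductSpace ℝ X] [CompleteSpace X]
  [NormedAddCommGroup Y] [InnerProductSpace ℝ Y] [CompleteSpace Y]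
  {f : X → ℝ} {f' : X → X} {A : X →L[ℝ] Y} {b : Y}

/-- The saddle point of a Tikhonov-regularized Lagrangian is no larger than any saddle point of
the Lagrangian. -/
lemma norm_sq_regularized_saddle_le (hf : ∀ u, HasGradientAt f (f' u) u)
    (hconv : ConvexOn ℝ Set.univ f) {xs u : X} {ls v : Y} {ε : ℝ} (hε : 0 < ε)
    (hfeas : A xs = b) (hls : ∀ u, f xs ≤ f u + ⟪ls, A u - b⟫)
    (hu : f' u + ContinuousLinearMap.adjoint A v + ε • u = 0) (hv : A u - b - ε • v = 0) :
    ‖u‖ ^ 2 + ‖v‖ ^ 2 ≤ ‖xs‖ ^ 2 + ‖ls‖ ^ 2 := by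
  have h1 := hconv.add_inner_gradient_le (hf u) xs
  have h2 := hls u
  have h3 : f' u = -(ContinuousLinearMap.adjoint A v + ε • u) := by
    rw [eq_neg_iff_add_eq_zero, ← hu]; abel
  have h4 : A u - b = ε • v := sub_eq_zero.mp hv
  have h5 : A (xs - u) = -(ε • v) := by rw [map_sub, hfeas, ← h4, neg_sub]
  rw [h3, inner_neg_left, inner_add_left, ContinuousLinearMap.adjoint_inner_left, h5,
    inner_neg_right, inner_smul_right, inner_smul_left, inner_sub_right] at h1
  rw [h4, inner_smul_right] at h2
  simp only [real_inner_self_eq_norm_sq, conj_trivial] at h1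
  have h6 : ε * (‖u‖ ^ 2 + ‖v‖ ^ 2) ≤ ε * (⟪u, xs⟫ + ⟪ls, v⟫) := by nlinarith
  have h7 := le_of_mul_le_mul_left h6 hε
  have h8 := norm_sub_sq_real u xs
  have h9 := norm_sub_sq_real ls v
  nlinarith [sq_nonneg ‖u - xs‖, sq_nonneg ‖ls - v‖]

/-- The regularized saddle path moves with speed at most `p / t` times its norm. -/
lemma norm_sq_deriv_regularized_saddle_le (hf : ∀ u, HasGradientAt f (f' u) u)
    (hconv : ConvexOn ℝ Set.univ f) {c p t : ℝ} (hc : 0 < c) (ht : 0 < t)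
    {u : ℝ → X} {v : ℝ → Y} {u' : X} {v' : Y}
    (hu : ∀ᶠ τ in 𝓝 t,
      f' (u τ) + ContinuousLinearMap.adjoint A (v τ) + (c / τ ^ p) • u τ = 0)
    (hv : ∀ᶠ τ in 𝓝 t, A (u τ) - b - (c / τ ^ p) • v τ = 0)
    (hu' : HasDerivAt u u' t) (hv' : HasDerivAt v v' t) :
    ‖u'‖ ^ 2 + ‖v'‖ ^ 2 ≤ (p / t) ^ 2 * (‖u t‖ ^ 2 + ‖v t‖ ^ 2) := by
  set ε : ℝ → ℝ := fun τ => c / τ ^ p with hεdef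
  have htp : 0 < t ^ p := rpow_pos_of_pos ht p
  have hεt : 0 < ε t := div_pos hc htp
  have hε' : HasDerivAt ε (-(p / t) * ε t) t := by
    have h := ((hasDerivAt_rpow_const (p := p) (Or.inl ht.ne')).fun_inv htp.ne').const_mul c
    refine (h.congr_deriv ?_).congr_of_eventuallyEq ?_
    · rw [rpow_sub_one ht.ne', hεdef]; field_simp
    · filter_upwards with τ
      simp [hεdef, div_eq_mul_inv]
  have hsu := (hε'.fun_smul hu').tendsto_slope
  have hsv := (hε'.fun_smul hv').tendsto_slope
  have hlim := (hsu.inner (𝕜 := ℝ) hu'.tendsto_slope).add (hsv.inner (𝕜 := ℝ) hv'.tendsto_slope)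
  have hle : ∀ᶠ τ in 𝓝[≠] t, ⟪slope (fun τ => ε τ • u τ) t τ, slope u t τ⟫
      + ⟪slope (fun τ => ε τ • v τ) t τ, slope v t τ⟫ ≤ 0 := by
    filter_upwards [nhdsWithin_le_nhds hu, nhdsWithin_le_nhds hv] with τ huτ hvτ
    have hut := hu.self_of_nhds
    have hvt := hv.self_of_nhds
    have hmono := hconv.inner_gradient_sub_nonneg hf (u τ) (u t)
    have e1 : f' (u τ) - f' (u t)
        = -(ContinuousLinearMap.adjoint A (v τ - v t)) - (ε τ • u τ - ε t • u t) := by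
      have a1 : f' (u τ) = -(ContinuousLinearMap.adjoint A (v τ) + ε τ • u τ) := by
        rw [eq_neg_iff_add_eq_zero, ← huτ]; abel
      have a2 : f' (u t) = -(ContinuousLinearMap.adjoint A (v t) + ε t • u t) := by
        rw [eq_neg_iff_add_eq_zero, ← hut]; abel
      rw [a1, a2, map_sub]; abel
    have e2 : A (u τ - u t) = ε τ • v τ - ε t • v t := by
      rw [map_sub, ← sub_eq_zero.mp hvτ, ← sub_eq_zero.mp hvt]; abel
    rw [e1, inner_sub_left, inner_neg_left, ContinuousLinearMap.adjoint_inner_left, e2,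
      real_inner_comm] at hmono
    simp only [slope, vsub_eq_sub, inner_smul_left, inner_smul_right, conj_trivial]
    have := mul_nonneg (mul_self_nonneg ((τ - t)⁻¹)) hmono
    nlinarith
  have hfin := le_of_tendsto hlim hle
  simp only [inner_add_left, inner_smul_left, conj_trivial, real_inner_self_eq_norm_sq] at hfin
  have hfin2 : ε t * (‖u'‖ ^ 2 + ‖v'‖ ^ 2) ≤ ε t * (p / t * (⟪u t, u'⟫ + ⟪v t, v'⟫)) := by
    nlinarith
  have hfin3 := le_of_mul_le_mul_left hfin2 hεt
  have h8 := norm_sub_sq_real ((p / t) • u t) u'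
  have h9 := norm_sub_sq_real ((p / t) • v t) v'
  rw [norm_smul, mul_pow, inner_smul_left, norm_eq_abs, sq_abs, conj_trivial] at h8 h9
  nlinarith [sq_nonneg ‖(p / t) • u t - u'‖, sq_nonneg ‖(p / t) • v t - v'‖]

end SaddlePath

section Energy

variable {X Y : Type*} [NormedAddCommGroup X] [InnerProductSpace ℝ X] [CompleteSpace X]
  [NormedAddCommGroup Y] [InnerProductSpace ℝ Y] [CompleteSpace Y]

/-- The derivative of the Lyapunov energy along a trajectory. -/
lemma hasDerivAt_energy {f : X → ℝ} {f' : X → X} {A : X →L[ℝ] Y} {b : Y}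
    (hf : ∀ u, HasGradientAt f (f' u) u) {a γ S α t : ℝ} (ha : a = α - 1)
    {x x' g xt : ℝ → X} {lam lt : ℝ → Y} {Θ w ε R m : ℝ → ℝ}
    {x'' g' y : X} {lam' z : Y} {Θ' w' ε' R' m' β : ℝ}
    (hx : HasDerivAt x (x' t) t) (hx' : HasDerivAt x' x'' t) (hg : HasDerivAt g g' t)
    (hxt : HasDerivAt xt y t) (hlam : HasDerivAt lam lam' t) (hlt : HasDerivAt lt z t)
    (hΘ : HasDerivAt Θ Θ' t) (hw : HasDerivAt w w' t) (hε : HasDerivAt ε ε' t)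
    (hR : HasDerivAt R R' t) (hm : HasDerivAt m m' t) (hR0 : R t ≠ 0)
    (hgt : g t = f' (x t) + ContinuousLinearMap.adjoint A (lam t) + ε t • x t)
    (hu : f' (xt t) + ContinuousLinearMap.adjoint A (lt t) + ε t • xt t = 0)
    (hv : A (xt t) - b - ε t • lt t = 0)
    (hode : m t • x'' + (α / R t) • x' t + γ • g' + S • g t = 0)
    (hwt : w t = 1 - R' * m t - m' * R t) (hβ : β = R t * S - γ * R')
    (hΘt : Θ t = R t * m t * β + γ * R t * w t)
    (hlam' : lam' = (a * β) • (A (x t) - b - ε t • lam t) + Θ t • A (x' t)) :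
    HasDerivAt (fun τ => Θ τ * (f (x τ) - f (xt τ) + ⟪lt τ, A (x τ - xt τ)⟫
          + ε τ / 2 * (‖x τ‖ ^ 2 - ‖xt τ‖ ^ 2))
        + 1 / 2 * ‖a • (x τ - xt τ) + R τ • (m τ • x' τ + γ • g τ)‖ ^ 2
        + 1 / 2 * a * (w τ * ‖x τ - xt τ‖ ^ 2) + 1 / 2 * ‖lam τ - lt τ‖ ^ 2)
      (Θ' * (f (x t) - f (xt t) + ⟪lt t, A (x t - xt t)⟫ + ε t / 2 * (‖x t‖ ^ 2 - ‖xt t‖ ^ 2))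
        + Θ t * (⟪z, A (x t - xt t)⟫ + ε' / 2 * (‖x t‖ ^ 2 - ‖xt t‖ ^ 2))
        - a * β * ⟪f' (x t) + ContinuousLinearMap.adjoint A (lt t) + ε t • x t, x t - xt t⟫
        - a * w t * ⟪x t - xt t, y⟫ + 1 / 2 * a * w' * ‖x t - xt t‖ ^ 2
        - R t * m t * w t * ‖x' t‖ ^ 2 - γ * R t * β * ‖g t‖ ^ 2
        - a * ⟪a • (x t - xt t) + R t • (m t • x' t + γ • g t), y⟫
        - a * β * ε t * ‖lam t - lt t‖ ^ 2 - ⟪lam t - lt t, z⟫) t := by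
  have hfx : HasDerivAt (fun τ => f (x τ)) ⟪f' (x t), x' t⟫ t :=
    (hf (x t)).comp_hasDerivAt_inner hx
  have hfxt : HasDerivAt (fun τ => f (xt τ)) ⟪f' (xt t), y⟫ t :=
    (hf (xt t)).comp_hasDerivAt_inner hxt
  have hd := hx.fun_sub hxt
  have hAd : HasDerivAt (fun τ => A (x τ - xt τ)) (A (x' t - y)) t :=
    A.hasFDerivAt.comp_hasDerivAt t hd
  have hφ := ((hfx.fun_sub hfxt).fun_add (hlt.inner ℝ hAd)).fun_add
    ((hε.div_const 2).fun_mul (hx.norm_sq.fun_sub hxt.norm_sq))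
  have hvel := (hd.fun_const_smul a).fun_add
    (hR.fun_smul ((hm.fun_smul hx').fun_add (hg.fun_const_smul γ)))
  have hE := (((hΘ.fun_mul hφ).fun_add (hvel.norm_sq.const_mul (1 / 2))).fun_add
    ((hw.fun_mul hd.norm_sq).const_mul (1 / 2 * a))).fun_add
    ((hlam.fun_sub hlt).norm_sq.const_mul (1 / 2))
  refine hE.congr_deriv ?_
  have hR1 : R t • (m t • x'' + γ • g') = -(α • x' t + (R t * S) • g t) := by
    have h1 := congrArg (fun k => R t • k) hode
    simp only [smul_add, smul_smul, smul_zero, mul_div_cancel₀ _ hR0] at h1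
    rw [eq_neg_iff_add_eq_zero, ← h1, smul_add, smul_smul, smul_smul]
    abel
  have hv' : a • (x' t - y) + (R t • (m t • x'' + m' • x' t + γ • g')
      + R' • (m t • x' t + γ • g t)) = -(w t • x' t + β • g t + a • y) := by
    have : R t • (m t • x'' + m' • x' t + γ • g') = R t • (m t • x'' + γ • g')
      + (R t * m') • x' t := by
      simp only [smul_add, smul_smul]; abel
    rw [this, hR1, hwt, hβ, ha]
    module
  have hl' : lam' = (a * β) • (A (x t - xt t) - ε t • (lam t - lt t)) + Θ t • A (x' t) := by
    rw [hlam', map_sub, smul_sub (ε t), ← sub_eq_zero.mp hv]; congr 2; abel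
  have hg2 : g t = (f' (x t) + ContinuousLinearMap.adjoint A (lt t) + ε t • x t)
      + ContinuousLinearMap.adjoint A (lam t - lt t) := by
    rw [hgt, map_sub]; abel
  have i1 : ⟪g t, x t - xt t⟫
      = ⟪f' (x t) + ContinuousLinearMap.adjoint A (lt t) + ε t • x t, x t - xt t⟫
        + ⟪lam t - lt t, A (x t - xt t)⟫ := by
    conv_lhs => rw [hg2]
    rw [inner_add_left, ContinuousLinearMap.adjoint_inner_left]
  have i2 : ⟪g t, x' t⟫
      = ⟪f' (x t), x' t⟫ + ⟪lt t, A (x' t)⟫ + ε t * ⟪x t, x' t⟫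
        + ⟪lam t - lt t, A (x' t)⟫ := by
    conv_lhs => rw [hg2]
    simp only [inner_add_left, ContinuousLinearMap.adjoint_inner_left, inner_smul_left,
      conj_trivial]
  have i3 : ⟪f' (xt t), y⟫ + ⟪lt t, A y⟫ + ε t * ⟪xt t, y⟫ = 0 := by
    have := congrArg (fun k => ⟪k, y⟫) hu
    simpa only [inner_add_left, ContinuousLinearMap.adjoint_inner_left, inner_smul_left,
      conj_trivial, inner_zero_left] using this
  rw [hv', hl']
  set d := x t - xt t
  set e := lam t - lt t
  set G := f' (x t) + ContinuousLinearMap.adjoint A (lt t) + ε t • x t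
  have hAy : A (x' t - y) = A (x' t) - A y := map_sub _ _ _
  rw [hAy]
  have c1 : ⟪x' t, g t⟫ = ⟪g t, x' t⟫ := real_inner_comm _ _
  have c2 : ⟪d, g t⟫ = ⟪g t, d⟫ := real_inner_comm _ _
  simp only [inner_add_left, inner_add_right, inner_sub_right, inner_neg_right, inner_smul_left,
    inner_smul_right, conj_trivial, real_inner_self_eq_norm_sq, c1, c2]
  linear_combination (-Θ t) * i2 - (a * β) * i1 - Θ t * i3 + ⟪g t, x' t⟫ * hΘt

end Energy

section ScalarEstimates

lemma mul_le_young {δ : ℝ} (hδ : 0 < δ) (u v : ℝ) : u * v ≤ δ * u ^ 2 + v ^ 2 / (4 * δ) := by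
  have h : δ * u ^ 2 + v ^ 2 / (4 * δ) - u * v = (2 * δ * u - v) ^ 2 / (4 * δ) := by
    field_simp
    ring
  have : 0 ≤ (2 * δ * u - v) ^ 2 / (4 * δ) := by positivity
  linarith

set_option maxHeartbeats 800000 in
/-- Estimates on the time-dependent coefficients of the energy, at a fixed large time `t`, where
`R`, `S` stand for `t ^ q`, `t ^ s` and `m`, `m₁`, `m₂` for the mass and its derivatives. -/
lemma coefficient_bounds {a γ q s k₁ k₂ t R S m m₁ m₂ w w' β : ℝ}
    (hγ : 0 < γ) (hq0 : 0 < q) (hq1 : q < 1) (hs : 0 < s) (hk₁ : 0 < k₁)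
    (hk₂ : 0 < k₂) (ht : 1 ≤ t) (hR : 1 ≤ R) (hS : 1 ≤ S) (hm : 0 < m)
    (hmR : m * R ≤ k₁) (hmRS : γ ≤ m * (R * S))
    (hm₁ : t * |m₁| ≤ k₂ * m) (hm₂ : t ^ 2 * |m₂| ≤ k₂ * m)
    (ht1 : 2 * γ * q ≤ t) (ht2 : 2 * (k₁ * (1 + k₂)) ≤ t)
    (ht3 : 4 * (k₁ * (1 + k₂) + k₁ * (1 + s + γ) + γ * (2 + k₁ * (1 + 3 * k₂))) ≤ a * t)
    (hβ : β = R * S - γ * (q * R / t))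
    (hw : w = 1 - q * R / t * m - m₁ * R)
    (hw' : w' = -(q * (q - 1) * R / t ^ 2 * m + q * R / t * m₁) - (m₂ * R + m₁ * (q * R / t))) :
    R * S / 2 ≤ β ∧ β ≤ R * S ∧ 1 / 2 ≤ w ∧ w ≤ 2 ∧ |w'| ≤ k₁ * (1 + 3 * k₂) / t ^ 2 ∧
    m * (R ^ 2 * S) / 2 ≤ R * m * β + γ * R * w ∧
    R * m * β + γ * R * w ≤ 3 * (m * (R ^ 2 * S)) ∧
    (q * R / t * m + R * m₁) * β + R * m * (q * R / t * S + R * (s * S / t)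
      - γ * (q * (q - 1) * R / t ^ 2)) + γ * (q * R / t * w + R * w') ≤ a * (R * S) / 4 := by
  have ht0 : 0 < t := by linarith
  have hR0 : 0 < R := by linarith
  have hS0 : 0 < S := by linarith
  have hRS : R ≤ R * S := le_mul_of_one_le_right hR0.le hS
  have b1 : |q * R / t * m| ≤ k₁ / t := by
    rw [abs_of_nonneg (by positivity), show q * R / t * m = q * (m * R) / t by ring]
    refine div_le_div_of_nonneg_right ?_ ht0.le
    exact (mul_le_of_le_one_left (by positivity) hq1.le).trans hmR
  have b2 : |m₁ * R| ≤ k₁ * k₂ / t := by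
    rw [abs_mul, abs_of_pos hR0, le_div_iff₀ ht0]
    linarith [mul_le_mul_of_nonneg_right hm₁ hR0.le, mul_le_mul_of_nonneg_left hmR hk₂.le]
  have b3 : |m₂ * R| ≤ k₁ * k₂ / t ^ 2 := by
    rw [abs_mul, abs_of_pos hR0, le_div_iff₀ (by positivity)]
    linarith [mul_le_mul_of_nonneg_right hm₂ hR0.le, mul_le_mul_of_nonneg_left hmR hk₂.le]
  have b4 : |q * R / t * m₁| ≤ k₁ * k₂ / t ^ 2 := by
    have : |q * R / t * m₁| = q / t * |m₁ * R| := by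
      rw [abs_mul, abs_mul, abs_of_pos hR0, abs_of_pos (by positivity : 0 < q * R / t)]; ring
    rw [this, show k₁ * k₂ / t ^ 2 = 1 / t * (k₁ * k₂ / t) by ring]
    gcongr
  have b5 : |q * (q - 1) * R / t ^ 2 * m| ≤ k₁ / t ^ 2 := by
    have : |q * (q - 1) * R / t ^ 2 * m| = q * (1 - q) * (m * R) / t ^ 2 := by
      rw [show q * (q - 1) * R / t ^ 2 * m = -(q * (1 - q) * (m * R) / t ^ 2) by ring, abs_neg,
        abs_of_nonneg]
      have : 0 ≤ 1 - q := by linarith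
      positivity
    rw [this]
    have h1 : q * (1 - q) ≤ 1 := by nlinarith
    refine div_le_div_of_nonneg_right ?_ (by positivity)
    exact (mul_le_of_le_one_left (by positivity) h1).trans hmR
  have c0 : γ * (q * R / t) ≤ R / 2 := by
    rw [← mul_div_assoc, div_le_div_iff₀ ht0 two_pos]
    linarith [mul_le_mul_of_nonneg_right ht1 hR0.le]
  have c0' : 0 ≤ γ * (q * R / t) := by positivity
  have hβ1 : R * S / 2 ≤ β := by rw [hβ]; linarith
  have hβ2 : β ≤ R * S := by rw [hβ]; linarith
  have c1 : k₁ / t + k₁ * k₂ / t ≤ 1 / 2 := by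
    rw [← add_div, div_le_div_iff₀ ht0 two_pos]; linarith
  obtain ⟨b1l, b1r⟩ := abs_le.mp b1
  obtain ⟨b2l, b2r⟩ := abs_le.mp b2
  have hw1 : 1 / 2 ≤ w := by rw [hw]; linarith
  have hw2 : w ≤ 3 / 2 := by rw [hw]; linarith
  have hw'1 : |w'| ≤ k₁ * (1 + 3 * k₂) / t ^ 2 := by
    have e : k₁ * (1 + 3 * k₂) / t ^ 2 = k₁ / t ^ 2 + 3 * (k₁ * k₂ / t ^ 2) := by ring
    rw [e, hw', abs_le]
    obtain ⟨_, _⟩ := abs_le.mp b3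
    obtain ⟨_, _⟩ := abs_le.mp b4
    obtain ⟨_, _⟩ := abs_le.mp b5
    have e2 : m₁ * (q * R / t) = q * R / t * m₁ := mul_comm _ _
    constructor <;> linarith
  have hmRp : 0 < R * m := by positivity
  have hγR : γ * R ≤ m * (R ^ 2 * S) := by
    linarith [mul_le_mul_of_nonneg_right hmRS hR0.le]
  refine ⟨hβ1, hβ2, hw1, by linarith, hw'1, ?_, ?_, ?_⟩
  · have := mul_le_mul_of_nonneg_left hβ1 hmRp.le
    have : 0 ≤ γ * R * w := by positivity
    linarith
  · have := mul_le_mul_of_nonneg_left hβ2 hmRp.le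
    have : γ * R * w ≤ γ * R * (3 / 2) := by gcongr
    have : 0 < m * (R ^ 2 * S) := by positivity
    linarith
  · have hβ0 : 0 ≤ β := le_trans (by positivity) hβ1
    have d1 : (q * R / t * m + R * m₁) * β ≤ k₁ * (1 + k₂) / t * (R * S) := by
      calc (q * R / t * m + R * m₁) * β ≤ (k₁ * (1 + k₂) / t) * β := by
            gcongr
            have : k₁ * (1 + k₂) / t = k₁ / t + k₁ * k₂ / t := by ring
            rw [this, mul_comm R m₁]; linarith
        _ ≤ _ := by gcongr
    have d2 : R * m * (q * R / t * S + R * (s * S / t) - γ * (q * (q - 1) * R / t ^ 2))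
        ≤ k₁ * (1 + s + γ) / t * (R * S) := by
      have i1 : q * R / t * S ≤ 1 / t * (R * S) := by
        rw [show q * R / t * S = q / t * (R * S) by ring]; gcongr
      have i2 : -(γ * (q * (q - 1) * R / t ^ 2)) ≤ γ / t * (R * S) := by
        have hqq : q * (1 - q) ≤ 1 := by nlinarith
        have htt : t ≤ t ^ 2 := le_self_pow₀ ht two_ne_zero
        calc -(γ * (q * (q - 1) * R / t ^ 2)) = γ * (q * (1 - q)) / t ^ 2 * R := by ring
          _ ≤ γ * 1 / t * (R * S) := by gcongr
          _ = _ := by ring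
      calc _ ≤ R * m * ((1 + s + γ) / t * (R * S)) := by
            gcongr
            have : (1 + s + γ) / t * (R * S) = 1 / t * (R * S) + R * (s * S / t)
              + γ / t * (R * S) := by ring
            linarith
        _ ≤ k₁ * ((1 + s + γ) / t * (R * S)) := by
            gcongr
            linarith
        _ = _ := by ring
    have d3 : γ * (q * R / t * w + R * w') ≤ γ * (2 + k₁ * (1 + 3 * k₂)) / t * (R * S) := by
      have i1 : q * R / t * w ≤ 2 / t * (R * S) := by
        calc q * R / t * w ≤ 1 * (R * S) / t * 2 := by
              gcongr
              linarith
          _ = _ := by ring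
      have i2 : R * w' ≤ (R * S) * (k₁ * (1 + 3 * k₂) / t) := by
        have htt : t ≤ t ^ 2 := le_self_pow₀ ht two_ne_zero
        calc R * w' ≤ R * |w'| := by gcongr; exact le_abs_self _
          _ ≤ (R * S) * (k₁ * (1 + 3 * k₂) / t ^ 2) := by gcongr
          _ ≤ _ := by gcongr
      calc _ ≤ γ * (2 / t * (R * S) + (R * S) * (k₁ * (1 + 3 * k₂) / t)) := by gcongr
        _ = _ := by ring
    have d4 : (k₁ * (1 + k₂) + k₁ * (1 + s + γ) + γ * (2 + k₁ * (1 + 3 * k₂))) / t ≤ a / 4 := by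
      rw [div_le_div_iff₀ ht0 (by norm_num)]; linarith
    calc _ ≤ (k₁ * (1 + k₂) + k₁ * (1 + s + γ) + γ * (2 + k₁ * (1 + 3 * k₂))) / t * (R * S) := by
          rw [add_div, add_div]; linarith
      _ ≤ a / 4 * (R * S) := by gcongr
      _ = _ := by ring

/-- The dissipation of the energy absorbs the perturbation terms, up to an integrable-type error
`m R² S V / t²`, and dominates a multiple `K / R` of the energy itself. -/
lemma dissipation_le {a γ c k₁ t R S V m w w' β Θ Θ' φ nd ne nx ng J G K C₁ C₂ C₃ C₄ : ℝ}
    (ha : 0 < a) (hγ : 0 < γ) (hc : 0 < c) (hk₁ : 0 < k₁) (ht : 1 ≤ t) (hR : 1 ≤ R)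
    (hS : 1 ≤ S) (hV : 1 ≤ V) (hVR : V ≤ R ^ 2 * S) (hm : 0 < m)
    (hmR : m * R ≤ k₁) (hmRS : γ ≤ m * (R * S))
    (hβ : R * S / 2 ≤ β) (hw : 1 / 2 ≤ w) (hw2 : w ≤ 2)
    (hw' : a / 2 * |w'| ≤ a * c / 16 * (R * S / V))
    (hΘ : Θ ≤ 3 * (m * (R ^ 2 * S))) (hΘ' : Θ' ≤ a * (R * S) / 4)
    (hφ : 0 ≤ φ) (hG : φ + c / V / 2 * nd ^ 2 ≤ G)
    (hJ : J ≤ C₁ * (m * (R ^ 2 * S) / t) * nd + C₂ * (R * m / t) * nx + C₃ * (R / t) * ng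
      + C₄ / t * ne)
    (hK : 0 < K) (hK1 : 3 * k₁ * K ≤ a / 4) (hK2 : K * (3 / 2 * a ^ 2 + a) ≤ a * c / 8)
    (hK3 : K / 2 ≤ a * c / 4) (hK4 : K * (3 / 2) * k₁ ≤ 1 / 4) (hK5 : K * (3 / 2) * γ ≤ 1 / 4) :
    Θ' * φ + J - a * β * G + 1 / 2 * a * w' * nd ^ 2 - R * m * w * nx ^ 2 - γ * R * β * ng ^ 2
      - a * β * (c / V) * ne ^ 2
    ≤ -(K / R) * (Θ * φ + 3 / 2 * (a ^ 2 * nd ^ 2 + R ^ 2 * m ^ 2 * nx ^ 2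
        + γ ^ 2 * R ^ 2 * ng ^ 2) + 1 / 2 * a * w * nd ^ 2 + 1 / 2 * ne ^ 2)
      + (4 * C₁ ^ 2 * k₁ / (a * c) + C₂ ^ 2 + C₃ ^ 2 / γ ^ 2 + C₄ ^ 2 / (a * c * γ))
        * (m * (R ^ 2 * S) * V / t ^ 2) := by
  have ht0 : 0 < t := by linarith
  have hR0 : 0 < R := by linarith
  have hS0 : 0 < S := by linarith
  have hV0 : 0 < V := by linarith
  set B := m * (R ^ 2 * S) * V / t ^ 2 with hB
  have hB1 : γ / t ^ 2 ≤ B := by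
    rw [hB]
    refine div_le_div_of_nonneg_right ?_ (by positivity)
    calc γ ≤ m * (R * S) := hmRS
      _ ≤ m * (R * S) * (R * V) :=
          le_mul_of_one_le_right (by positivity) (one_le_mul_of_one_le_of_one_le hR hV)
      _ = m * (R ^ 2 * S) * V := by ring
  have y1 : C₁ * (m * (R ^ 2 * S) / t) * nd
      ≤ a * c / 16 * (R * S / V) * nd ^ 2 + 4 * C₁ ^ 2 * k₁ / (a * c) * B := by
    have h := mul_le_young (δ := a * c / 16 * (R * S / V)) (by positivity) nd
      (C₁ * (m * (R ^ 2 * S) / t))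
    have e : (C₁ * (m * (R ^ 2 * S) / t)) ^ 2 / (4 * (a * c / 16 * (R * S / V)))
        = 4 * C₁ ^ 2 * (m * R) / (a * c) * B := by
      rw [hB]; field_simp; norm_num
    have : 4 * C₁ ^ 2 * (m * R) / (a * c) * B ≤ 4 * C₁ ^ 2 * k₁ / (a * c) * B := by
      gcongr
    linarith
  have y2 : C₂ * (R * m / t) * nx ≤ 1 / 4 * (R * m) * nx ^ 2 + C₂ ^ 2 * B := by
    have h := mul_le_young (δ := 1 / 4 * (R * m)) (by positivity) nx (C₂ * (R * m / t))
    have e : (C₂ * (R * m / t)) ^ 2 / (4 * (1 / 4 * (R * m))) = C₂ ^ 2 * (m * R / t ^ 2) := by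
      field_simp
    have : C₂ ^ 2 * (m * R / t ^ 2) ≤ C₂ ^ 2 * B := by
      rw [hB]
      refine mul_le_mul_of_nonneg_left (div_le_div_of_nonneg_right ?_ (by positivity))
        (sq_nonneg _)
      have h1 : 1 ≤ R * S * V :=
        one_le_mul_of_one_le_of_one_le (one_le_mul_of_one_le_of_one_le hR hS) hV
      calc m * R ≤ m * R * (R * S * V) := le_mul_of_one_le_right (by positivity) h1
        _ = m * (R ^ 2 * S) * V := by ring
    linarith
  have y3 : C₃ * (R / t) * ng ≤ γ / 4 * (R ^ 2 * S) * ng ^ 2 + C₃ ^ 2 / γ ^ 2 * B := by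
    have h := mul_le_young (δ := γ / 4 * (R ^ 2 * S)) (by positivity) ng (C₃ * (R / t))
    have e : (C₃ * (R / t)) ^ 2 / (4 * (γ / 4 * (R ^ 2 * S))) = C₃ ^ 2 / γ ^ 2 * (γ / t ^ 2 / S) := by
      field_simp
    have : C₃ ^ 2 / γ ^ 2 * (γ / t ^ 2 / S) ≤ C₃ ^ 2 / γ ^ 2 * B := by
      gcongr
      exact (div_le_self (by positivity) hS).trans hB1
    linarith
  have y4 : C₄ / t * ne ≤ a * c / 4 * (R * S / V) * ne ^ 2 + C₄ ^ 2 / (a * c * γ) * B := by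
    have h := mul_le_young (δ := a * c / 4 * (R * S / V)) (by positivity) ne (C₄ / t)
    have e : (C₄ / t) ^ 2 / (4 * (a * c / 4 * (R * S / V)))
        = C₄ ^ 2 / (a * c * γ) * (γ * V / (t ^ 2 * (R * S))) := by
      field_simp
    have : C₄ ^ 2 / (a * c * γ) * (γ * V / (t ^ 2 * (R * S))) ≤ C₄ ^ 2 / (a * c * γ) * B := by
      gcongr
      rw [hB, div_le_div_iff₀ (by positivity) (by positivity)]
      have h1 : 1 ≤ R * (R * S) := one_le_mul_of_one_le_of_one_le hR
        (one_le_mul_of_one_le_of_one_le hR hS)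
      have h2 : γ ≤ m * (R * S) * (R * (R * S)) :=
        hmRS.trans (le_mul_of_one_le_right (by positivity) h1)
      calc γ * V * t ^ 2 ≤ m * (R * S) * (R * (R * S)) * V * t ^ 2 := by gcongr
        _ = _ := by ring
    linarith
  have hβ0 : 0 < β := lt_of_lt_of_le (by positivity) hβ
  have g1 : a * (R * S / 2) * φ + a * c / 4 * (R * S / V) * nd ^ 2 ≤ a * β * G := by
    have h1 : a * β * (φ + c / V / 2 * nd ^ 2) ≤ a * β * G := by gcongr
    have h2 : a * (R * S / 2) * (φ + c / V / 2 * nd ^ 2)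
        ≤ a * β * (φ + c / V / 2 * nd ^ 2) := by gcongr
    have h3 : a * (R * S / 2) * (φ + c / V / 2 * nd ^ 2)
        = a * (R * S / 2) * φ + a * c / 4 * (R * S / V) * nd ^ 2 := by ring
    linarith
  have g2 : 1 / 2 * a * w' * nd ^ 2 ≤ a * c / 16 * (R * S / V) * nd ^ 2 := by
    refine mul_le_mul_of_nonneg_right ?_ (sq_nonneg _)
    calc 1 / 2 * a * w' ≤ 1 / 2 * a * |w'| := by gcongr; exact le_abs_self w'
      _ = a / 2 * |w'| := by ring
      _ ≤ _ := hw'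
  have g3 : 1 / 2 * (R * m) * nx ^ 2 ≤ R * m * w * nx ^ 2 := by
    refine mul_le_mul_of_nonneg_right ?_ (sq_nonneg _)
    linarith [mul_le_mul_of_nonneg_left hw (mul_pos hR0 hm).le]
  have g4 : γ / 2 * (R ^ 2 * S) * ng ^ 2 ≤ γ * R * β * ng ^ 2 := by
    refine mul_le_mul_of_nonneg_right ?_ (sq_nonneg _)
    linarith [mul_le_mul_of_nonneg_left hβ (mul_pos hγ hR0).le]
  have g5 : a * c / 2 * (R * S / V) * ne ^ 2 ≤ a * β * (c / V) * ne ^ 2 := by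
    have : a * c / 2 * (R * S / V) = a * (R * S / 2) * (c / V) := by ring
    rw [this]
    gcongr
  have g6 : Θ' * φ ≤ a * (R * S) / 4 * φ := by gcongr
  have hRV : 1 / R ≤ R * S / V := by
    rw [div_le_div_iff₀ hR0 hV0]; linarith
  have k1 : K / R * (Θ * φ) ≤ a * (R * S) / 4 * φ := by
    have : K / R * Θ ≤ a * (R * S) / 4 := by
      calc K / R * Θ ≤ K / R * (3 * (m * (R ^ 2 * S))) := by gcongr
        _ = 3 * (m * R) * K * S := by field_simp
        _ ≤ 3 * k₁ * K * (R * S) := by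
            gcongr
            exact le_mul_of_one_le_left hS0.le hR
        _ ≤ a / 4 * (R * S) := by gcongr
        _ = _ := by ring
    rw [← mul_assoc]
    gcongr
  have k2 : K / R * (3 / 2 * a ^ 2 * nd ^ 2 + 1 / 2 * a * w * nd ^ 2)
      ≤ a * c / 8 * (R * S / V) * nd ^ 2 := by
    calc _ ≤ K / R * (3 / 2 * a ^ 2 * nd ^ 2 + 1 / 2 * a * 2 * nd ^ 2) := by gcongr
      _ = K * (3 / 2 * a ^ 2 + a) * (1 / R) * nd ^ 2 := by ring
      _ ≤ _ := by gcongr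
  have k3 : K / R * (1 / 2 * ne ^ 2) ≤ a * c / 4 * (R * S / V) * ne ^ 2 := by
    calc _ = K / 2 * (1 / R) * ne ^ 2 := by ring
      _ ≤ _ := by gcongr
  have k4 : K / R * (3 / 2 * (R ^ 2 * m ^ 2 * nx ^ 2)) ≤ 1 / 4 * (R * m) * nx ^ 2 := by
    calc _ = K * (3 / 2) * m * (R * m) * nx ^ 2 := by field_simp
      _ ≤ K * (3 / 2) * k₁ * (R * m) * nx ^ 2 := by
          gcongr
          exact (le_mul_of_one_le_right hm.le hR).trans hmR
      _ ≤ _ := by gcongr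
  have k5 : K / R * (3 / 2 * (γ ^ 2 * R ^ 2 * ng ^ 2)) ≤ γ / 4 * (R ^ 2 * S) * ng ^ 2 := by
    calc _ = K * (3 / 2) * γ * (γ * R) * ng ^ 2 := by field_simp
      _ ≤ 1 / 4 * (γ * (R ^ 2 * S)) * ng ^ 2 := by
          gcongr
          calc R ≤ R * (R * S) :=
                le_mul_of_one_le_right hR0.le (one_le_mul_of_one_le_of_one_le hR hS)
            _ = R ^ 2 * S := by ring
      _ = _ := by ring
  linarith

/-- Comparison principle for `E' ≤ -K t^{-q} E + C m t^{2q+s+p-2}`. -/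
lemma le_of_deriv_energy_le {E m m' : ℝ → ℝ} {q s p K C k₂ T : ℝ} (hT : 1 ≤ T)
    (hq : q < 1) (hq0 : 0 < q) (hK : 0 < K) (hC : 0 ≤ C) (hk₂ : 0 < k₂)
    (hE : ∀ t ≥ T, ∃ D, HasDerivAt E D t ∧ D ≤ -(K / t ^ q) * E t
      + C * (m t * ((t ^ q) ^ 2 * t ^ s) * t ^ p / t ^ 2)) (hm : ∀ t ≥ T, HasDerivAt m (m' t) t)
    (hmpos : ∀ t ≥ T, 0 < m t) (hm' : ∀ t ≥ T, t * |m' t| ≤ k₂ * m t) :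
    ∃ M > 0, ∀ᶠ t in atTop, E t ≤ M * (m t * t ^ (4 * q + s + p - 2)) := by
  choose! E' hE hE' using hE
  set e := 4 * q + s + p - 2 with he
  have hlim : Tendsto (fun t : ℝ => t ^ (-(1 - q))) atTop (𝓝 0) :=
    tendsto_rpow_neg_atTop (by linarith)
  have hev := hlim.eventually (gt_mem_nhds (show 0 < K / (4 * (k₂ + |e|)) by positivity))
  obtain ⟨T', hT'⟩ := eventually_atTop.mp hev
  set T₀ := max T T' with hT₀
  have hT₀pos : 0 < T₀ := by linarith [le_max_left T T']
  have hB0 : 0 < m T₀ * T₀ ^ e := mul_pos (hmpos _ (le_max_left _ _)) (rpow_pos_of_pos hT₀pos _)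
  set M := max (2 * C / K + 1) (E T₀ / (m T₀ * T₀ ^ e)) with hM
  have hM1 : 2 * C / K + 1 ≤ M := le_max_left _ _
  have hM0 : 0 < M := lt_of_lt_of_le (by positivity) hM1
  refine ⟨M, hM0, ?_⟩
  filter_upwards [eventually_ge_atTop T₀] with t ht
  have hB : ∀ τ ≥ T₀, HasDerivAt (fun τ => M * (m τ * τ ^ e))
      (M * (m' τ * τ ^ e + m τ * (e * τ ^ (e - 1)))) τ := fun τ hτ =>
    ((hm τ ((le_max_left _ _).trans hτ)).fun_mul
      (hasDerivAt_rpow_const (Or.inl (hT₀pos.trans_le hτ).ne'))).const_mul M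
  refine image_le_of_deriv_right_lt_deriv_boundary' (a := T₀) (b := t) (f := E) (f' := E')
    (B := fun τ => M * (m τ * τ ^ e))
    (B' := fun τ => M * (m' τ * τ ^ e + m τ * (e * τ ^ (e - 1))))
    (fun τ hτ => (hE τ ((le_max_left _ _).trans hτ.1)).continuousAt.continuousWithinAt)
    (fun τ hτ => (hE τ ((le_max_left _ _).trans hτ.1)).hasDerivWithinAt)
    ?_ (fun τ hτ => (hB τ hτ.1).continuousAt.continuousWithinAt)
    (fun τ hτ => (hB τ hτ.1).hasDerivWithinAt) ?_ ⟨ht, le_refl t⟩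
  · exact (div_le_iff₀ hB0).mp (le_max_right _ _)
  · intro τ hτ hEB
    have hτT : T ≤ τ := (le_max_left _ _).trans hτ.1
    have hτ1 : 1 ≤ τ := hT.trans hτT
    have hτ0 : 0 < τ := by linarith
    have hder := hE' τ hτT
    have hsmall := hT' τ ((le_max_right _ _).trans hτ.1)
    have hm'τ := hm' τ hτT
    have hmτ := hmpos τ hτT
    rw [hEB] at hder
    have hR1 : 1 ≤ τ ^ q := one_le_rpow hτ1 hq0.le
    set R := τ ^ q with hR
    set Z := τ ^ s * τ ^ p / τ ^ 2 with hZ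
    have hR0 : 0 < R := by linarith
    have hZ0 : 0 < Z := by positivity
    have hpe : τ ^ e = R ^ 4 * Z := by
      rw [he, rpow_sub hτ0, rpow_add hτ0, rpow_add hτ0, hZ, hR,
        show 4 * q = q * (4 : ℕ) by push_cast; ring, rpow_mul_natCast hτ0.le, rpow_ofNat]
      ring
    have hqe : τ ^ (-(1 - q)) = R / τ := by
      rw [neg_sub, rpow_sub_one hτ0.ne']
    have hpe1 : τ ^ (e - 1) = R ^ 4 * Z / τ := by rw [rpow_sub_one hτ0.ne', hpe]
    rw [hqe, lt_div_iff₀ (by positivity)] at hsmall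
    rw [hpe] at hder
    simp only [hpe, hpe1]
    have h1 : -(k₂ * m τ / τ) ≤ m' τ := by
      have : |m' τ| ≤ k₂ * m τ / τ := by rw [le_div_iff₀ hτ0]; linarith
      exact (abs_le.mp this).1
    have h2 : -(M * (m τ * R ^ 3 * Z) * (R / τ * (k₂ + |e|)))
        ≤ M * (m' τ * (R ^ 4 * Z) + m τ * (e * (R ^ 4 * Z / τ))) := by
      have : -(M * (m τ * R ^ 3 * Z) * (R / τ * (k₂ + |e|)))
        = M * (-(k₂ * m τ / τ) * (R ^ 4 * Z) + m τ * (-|e| * (R ^ 4 * Z / τ))) := by ring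
      rw [this]
      gcongr
      exact neg_abs_le e
    have h3 : M * (m τ * R ^ 3 * Z) * (R / τ * (k₂ + |e|)) ≤ M * (m τ * R ^ 3 * Z) * (K / 4) := by
      gcongr
      linarith
    have h4 : C * (m τ * (R ^ 2 * τ ^ s) * τ ^ p / τ ^ 2) ≤ M * (m τ * R ^ 3 * Z) * (K / 2) := by
      have hCM : C ≤ M * (K / 2) := by
        have : 2 * C / K ≤ M := by linarith
        rw [div_le_iff₀ hK] at this
        linarith
      have hRR : R ^ 2 ≤ R ^ 3 := pow_le_pow_right₀ hR1 (by norm_num)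
      calc C * (m τ * (R ^ 2 * τ ^ s) * τ ^ p / τ ^ 2) = C * (m τ * R ^ 2 * Z) := by
            rw [hZ]; ring
        _ ≤ (M * (K / 2)) * (m τ * R ^ 3 * Z) := by gcongr
        _ = _ := by ring
    have h5 : -(K / R) * (M * (m τ * (R ^ 4 * Z))) = -(M * (m τ * R ^ 3 * Z) * K) := by
      field_simp
    have h6 : 0 < M * (m τ * R ^ 3 * Z) * K := by positivity
    linarith

end ScalarEstimates

section EnergyDecay

variable {X Y : Type*} [NormedAddCommGroup X] [InnerProductSpace ℝ X]
  [NormedAddCommGroup Y] [InnerProductSpace ℝ Y]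

lemma perturbation_le {A : X →L[ℝ] Y} {u v y x' g : X} {e z : Y}
    {a γ c p t R S V m w Θ H : ℝ} (ha : 0 < a) (hγ : 0 < γ) (hc : 0 < c) (hp0 : 0 < p)
    (hp1 : p ≤ 1) (ht : 0 < t) (hR : 1 ≤ R) (hV : 1 ≤ V) (hm : 0 < m)
    (hmRS : γ ≤ m * (R * S)) (hw : 0 ≤ w) (hw2 : w ≤ 2) (hΘ0 : 0 ≤ Θ)
    (hΘ : Θ ≤ 3 * (m * (R ^ 2 * S))) (hv : ‖v‖ ≤ H) (hy : ‖y‖ ≤ H / t) (hz : ‖z‖ ≤ H / t) :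
    Θ * (⟪z, A (u - v)⟫ + -(p / t) * (c / V) / 2 * (‖u‖ ^ 2 - ‖v‖ ^ 2)) - a * w * ⟪u - v, y⟫
      - a * ⟪a • (u - v) + R • (m • x' + γ • g), y⟫ - ⟪e, z⟫
    ≤ (3 * H * (‖A‖ + c) + (2 * a * H + a ^ 2 * H) / γ) * (m * (R ^ 2 * S) / t) * ‖u - v‖
      + a * H * (R * m / t) * ‖x'‖ + a * γ * H * (R / t) * ‖g‖ + H / t * ‖e‖ := by
  have hH : 0 ≤ H := (norm_nonneg _).trans hv
  have hR0 : 0 < R := by linarith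
  have hN : γ ≤ m * (R ^ 2 * S) := by
    calc γ ≤ m * (R * S) := hmRS
      _ ≤ m * (R * S) * R := le_mul_of_one_le_right (hγ.le.trans hmRS) hR
      _ = _ := by ring
  have j1 : ⟪z, A (u - v)⟫ ≤ H / t * (‖A‖ * ‖u - v‖) :=
    (real_inner_le_norm _ _).trans (mul_le_mul hz (A.le_opNorm _) (norm_nonneg _) (by positivity))
  have j2 : -(p / t) * (c / V) / 2 * (‖u‖ ^ 2 - ‖v‖ ^ 2) ≤ H / t * (c * ‖u - v‖) := by
    have h1 : ‖v‖ ^ 2 - ‖u‖ ^ 2 ≤ 2 * (H * ‖u - v‖) := by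
      have hs : ‖v‖ ^ 2 - ‖u‖ ^ 2 = -2 * ⟪v, u - v⟫ - ‖u - v‖ ^ 2 := by
        rw [norm_sub_sq_real, inner_sub_right, real_inner_self_eq_norm_sq, real_inner_comm]; ring
      have h2 : -⟪v, u - v⟫ ≤ H * ‖u - v‖ :=
        ((neg_le_abs _).trans (abs_real_inner_le_norm _ _)).trans (by gcongr)
      nlinarith [sq_nonneg ‖u - v‖]
    calc -(p / t) * (c / V) / 2 * (‖u‖ ^ 2 - ‖v‖ ^ 2)
        = p / t * (c / V) / 2 * (‖v‖ ^ 2 - ‖u‖ ^ 2) := by ring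
      _ ≤ p / t * (c / V) / 2 * (2 * (H * ‖u - v‖)) := by gcongr
      _ ≤ 1 / t * (c / 1) / 2 * (2 * (H * ‖u - v‖)) := by gcongr
      _ = _ := by ring
  have j3 : -(a * w * ⟪u - v, y⟫) ≤ a * 2 * (‖u - v‖ * (H / t)) := by
    have h2 : -⟪u - v, y⟫ ≤ ‖u - v‖ * (H / t) :=
      ((neg_le_abs _).trans (abs_real_inner_le_norm _ _)).trans (by gcongr)
    calc -(a * w * ⟪u - v, y⟫) = a * w * (-⟪u - v, y⟫) := by ring
      _ ≤ a * w * (‖u - v‖ * (H / t)) := by gcongr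
      _ ≤ _ := by gcongr
  have j4 : -(a * ⟪a • (u - v) + R • (m • x' + γ • g), y⟫)
      ≤ a * ((a * ‖u - v‖ + R * (m * ‖x'‖ + γ * ‖g‖)) * (H / t)) := by
    have hn : ‖a • (u - v) + R • (m • x' + γ • g)‖ ≤ a * ‖u - v‖ + R * (m * ‖x'‖ + γ * ‖g‖) := by
      refine (norm_add_le _ _).trans ?_
      rw [norm_smul, norm_smul, norm_of_nonneg ha.le, norm_of_nonneg hR0.le]
      gcongr
      refine (norm_add_le _ _).trans ?_
      rw [norm_smul, norm_smul, norm_of_nonneg hm.le, norm_of_nonneg hγ.le]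
    have h2 : -⟪a • (u - v) + R • (m • x' + γ • g), y⟫
        ≤ (a * ‖u - v‖ + R * (m * ‖x'‖ + γ * ‖g‖)) * (H / t) :=
      ((neg_le_abs _).trans (abs_real_inner_le_norm _ _)).trans (by gcongr)
    calc _ = a * (-⟪a • (u - v) + R • (m • x' + γ • g), y⟫) := by ring
      _ ≤ _ := by gcongr
  have j5 : -⟪e, z⟫ ≤ H / t * ‖e‖ :=
    ((neg_le_abs _).trans (abs_real_inner_le_norm _ _)).trans (by rw [mul_comm]; gcongr)
  have j6 : Θ * (⟪z, A (u - v)⟫ + -(p / t) * (c / V) / 2 * (‖u‖ ^ 2 - ‖v‖ ^ 2))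
      ≤ 3 * (m * (R ^ 2 * S)) * (H / t * (‖A‖ * ‖u - v‖) + H / t * (c * ‖u - v‖)) :=
    (mul_le_mul_of_nonneg_left (add_le_add j1 j2) hΘ0).trans
      (mul_le_mul_of_nonneg_right hΘ (by positivity))
  have j7 : (2 * a * H + a ^ 2 * H) / t * ‖u - v‖
      ≤ (2 * a * H + a ^ 2 * H) / γ * (m * (R ^ 2 * S) / t) * ‖u - v‖ := by
    gcongr
    rw [div_mul_div_comm, div_le_div_iff₀ ht (by positivity)]
    calc _ = (2 * a * H + a ^ 2 * H) * t * γ := by ring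
      _ ≤ (2 * a * H + a ^ 2 * H) * t * (m * (R ^ 2 * S)) := by gcongr
      _ = _ := by ring
  have e1 : (3 * H * (‖A‖ + c) + (2 * a * H + a ^ 2 * H) / γ) * (m * (R ^ 2 * S) / t) * ‖u - v‖
      = 3 * (m * (R ^ 2 * S)) * (H / t * (‖A‖ * ‖u - v‖) + H / t * (c * ‖u - v‖))
        + (2 * a * H + a ^ 2 * H) / γ * (m * (R ^ 2 * S) / t) * ‖u - v‖ := by ring
  have e2 : a * 2 * (‖u - v‖ * (H / t)) + a * ((a * ‖u - v‖ + R * (m * ‖x'‖ + γ * ‖g‖)) * (H / t))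
      = (2 * a * H + a ^ 2 * H) / t * ‖u - v‖ + a * H * (R * m / t) * ‖x'‖
        + a * γ * H * (R / t) * ‖g‖ := by ring
  linarith

lemma norm_sq_velocity_le (d x' g : X) (a γ R m : ℝ) :
    ‖a • d + R • (m • x' + γ • g)‖ ^ 2
      ≤ 3 * (a ^ 2 * ‖d‖ ^ 2 + R ^ 2 * m ^ 2 * ‖x'‖ ^ 2 + γ ^ 2 * R ^ 2 * ‖g‖ ^ 2) := by
  have h : ‖a • d + R • (m • x' + γ • g)‖ ≤ |a| * ‖d‖ + |R| * |m| * ‖x'‖ + |γ| * |R| * ‖g‖ := by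
    rw [smul_add, smul_smul, smul_smul, ← add_assoc]
    refine (norm_add₃_le).trans (le_of_eq ?_)
    simp only [norm_smul, norm_eq_abs, abs_mul]
    ring
  have h2 := pow_le_pow_left₀ (norm_nonneg _) h 2
  have h3 : ∀ u v w : ℝ, (u + v + w) ^ 2 ≤ 3 * (u ^ 2 + v ^ 2 + w ^ 2) := fun u v w => by
    nlinarith [sq_nonneg (u - v), sq_nonneg (v - w), sq_nonneg (u - w)]
  refine h2.trans ((h3 _ _ _).trans (le_of_eq ?_))
  simp only [mul_pow, sq_abs]

variable [CompleteSpace X] [CompleteSpace Y]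

set_option maxHeartbeats 1000000 in
/-- Decay of the gap of the regularized Lagrangian and of the distance to the regularized saddle
path along a trajectory of the mixed-order dynamical system. -/
lemma regularized_gap_decay {f : X → ℝ} {f' : X → X} (hf : ∀ u, HasGradientAt f (f' u) u)
    (hconv : ConvexOn ℝ Set.univ f) {A : X →L[ℝ] Y} {b : Y} {c p t₀ H : ℝ} (hc : 0 < c)
    (hp0 : 0 < p) (hp1 : p < 1) (ht₀ : 0 < t₀)
    {α q γ s : ℝ} (hα : 1 < α) (hq0 : 0 < q) (hq1 : q < 1) (hγ : 0 < γ) (hs : 0 < s)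
    {m m' m'' : ℝ → ℝ} (hmpos : ∀ t ≥ t₀, 0 < m t) (hmd : ∀ t ≥ t₀, HasDerivAt m (m' t) t)
    (hmd2 : ∀ t ≥ t₀, HasDerivAt m' (m'' t) t) {θ : ℝ → ℝ}
    (hθ : ∀ t, θ t = (m t * t ^ (2*q+s) + γ * t ^ q - 2 * m t * γ * q * t ^ (2*q-1)
      - γ * m' t * t ^ (2*q)) / ((α - 1) * (t ^ (q+s) - γ * q * t ^ (q-1))))
    {k₁ k₂ T₁ T₂ : ℝ} (hk₁ : 0 < k₁) (hk₂ : 0 < k₂)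
    (hA1 : ∀ t ≥ T₁, γ / t ^ (q+s) ≤ m t ∧ m t ≤ k₁ / t ^ q)
    (hA2 : ∀ t ≥ T₂, t * |m' t| ≤ k₂ * m t ∧ t ^ 2 * |m'' t| ≤ k₂ * m t)
    {x x' x'' g gder xt xt' : ℝ → X} {lam lam' lt lt' : ℝ → Y}
    (hx : ∀ t ≥ t₀, HasDerivAt x (x' t) t) (hx' : ∀ t ≥ t₀, HasDerivAt x' (x'' t) t)
    (hlam : ∀ t ≥ t₀, HasDerivAt lam (lam' t) t)
    (hg : ∀ t, g t = f' (x t) + ContinuousLinearMap.adjoint A (lam t) + (c / t ^ p) • x t)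
    (hgder : ∀ t ≥ t₀, HasDerivAt g (gder t) t)
    (hode1 : ∀ t ≥ t₀, m t • x'' t + (α / t ^ q) • x' t + γ • gder t + t ^ s • g t = 0)
    (hode2 : ∀ t ≥ t₀, lam' t = ((α - 1) * (t ^ (q+s) - γ * q * t ^ (q-1)))
      • (A (x t + θ t • x' t) - b - (c / t ^ p) • lam t))
    (hu : ∀ t ≥ t₀, f' (xt t) + ContinuousLinearMap.adjoint A (lt t) + (c / t ^ p) • xt t = 0)
    (hv : ∀ t ≥ t₀, A (xt t) - b - (c / t ^ p) • lt t = 0)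
    (hxt : ∀ t ≥ t₀, HasDerivAt xt (xt' t) t) (hlt : ∀ t ≥ t₀, HasDerivAt lt (lt' t) t)
    (hH : 0 ≤ H) (hbd : ∀ t ≥ t₀, ‖xt t‖ ^ 2 + ‖lt t‖ ^ 2 ≤ H ^ 2) (hp3 : p < 2*q + s) :
    ∃ M > 0, ∀ᶠ t in atTop,
      f (x t) - f (xt t) + ⟪lt t, A (x t - xt t)⟫ + c / t ^ p / 2 * (‖x t‖ ^ 2 - ‖xt t‖ ^ 2)
        ≤ M * t ^ (2 * q + p - 2) ∧
      ‖x t - xt t‖ ^ 2 ≤ M * (m t * t ^ (4 * q + s + p - 2)) ∧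
      ‖lam t - lt t‖ ^ 2 ≤ M * (m t * t ^ (4 * q + s + p - 2)) := by
  set a := α - 1 with ha_def
  have ha : 0 < a := by linarith
  set Rd : ℝ → ℝ := fun τ => q * τ ^ (q - 1) with hRd_def
  set β : ℝ → ℝ := fun τ => τ ^ q * τ ^ s - γ * Rd τ with hβ_def
  set w : ℝ → ℝ := fun τ => 1 - Rd τ * m τ - m' τ * τ ^ q with hw_def
  set Θ : ℝ → ℝ := fun τ => τ ^ q * m τ * β τ + γ * τ ^ q * w τ with hΘ_def
  set φ : ℝ → ℝ := fun τ => f (x τ) - f (xt τ) + ⟪lt τ, A (x τ - xt τ)⟫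
          + c / τ ^ p / 2 * (‖x τ‖ ^ 2 - ‖xt τ‖ ^ 2) with hφ_def
  set E : ℝ → ℝ := fun τ => Θ τ * φ τ
        + 1 / 2 * ‖a • (x τ - xt τ) + τ ^ q • (m τ • x' τ + γ • g τ)‖ ^ 2
        + 1 / 2 * a * (w τ * ‖x τ - xt τ‖ ^ 2) + 1 / 2 * ‖lam τ - lt τ‖ ^ 2 with hE_def
  obtain ⟨K, hK, hK1, hK2, hK3, hK4, hK5⟩ : ∃ K > 0, 3 * k₁ * K ≤ a / 4 ∧
      K * (3 / 2 * a ^ 2 + a) ≤ a * c / 8 ∧ K / 2 ≤ a * c / 4 ∧ K * (3 / 2) * k₁ ≤ 1 / 4 ∧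
      K * (3 / 2) * γ ≤ 1 / 4 := by
    have hlim : ∀ l r : ℝ, 0 < r → ∀ᶠ K : ℝ in 𝓝[>] 0, K * l ≤ r := fun l r hr => by
      have : Tendsto (fun K : ℝ => K * l) (𝓝[>] 0) (𝓝 (0 * l)) :=
        (tendsto_nhdsWithin_of_tendsto_nhds tendsto_id).mul_const l
      rw [zero_mul] at this
      filter_upwards [this.eventually (gt_mem_nhds hr)] with K hK using hK.le
    obtain ⟨K, hK, h1, h2, h3, h4, h5⟩ := (eventually_mem_nhdsWithin.and
      ((hlim (3 * k₁) (a / 4) (by positivity)).and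
      ((hlim (3 / 2 * a ^ 2 + a) (a * c / 8) (by positivity)).and
      ((hlim (1 / 2) (a * c / 4) (by positivity)).and
      ((hlim (3 / 2 * k₁) (1 / 4) (by positivity)).and
      (hlim (3 / 2 * γ) (1 / 4) (by positivity))))))).exists
    exact ⟨K, hK, by linarith, h2, by linarith, by linarith, by linarith⟩
  set C₁ := 3 * H * (‖A‖ + c) + (2 * a * H + a ^ 2 * H) / γ
  set C := 4 * C₁ ^ 2 * k₁ / (a * c) + (a * H) ^ 2 + (a * γ * H) ^ 2 / γ ^ 2
    + H ^ 2 / (a * c * γ) with hC_def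
  have hC : 0 ≤ C := by positivity
  obtain ⟨T, hT⟩ := eventually_atTop.mp ((eventually_gt_atTop t₀).and
    ((eventually_ge_atTop (max T₁ T₂)).and ((eventually_ge_atTop (1 : ℝ)).and
    ((eventually_ge_atTop (2 * γ * q)).and ((eventually_ge_atTop (2 * (k₁ * (1 + k₂)))).and
    ((eventually_ge_atTop ((4 * (k₁ * (1 + k₂) + k₁ * (1 + s + γ)
      + γ * (2 + k₁ * (1 + 3 * k₂)))) / a)).and
    (eventually_ge_atTop (8 * (k₁ * (1 + 3 * k₂)) / c))))))))
  have hpow : ∀ t ≥ T, 1 ≤ t ^ q ∧ 1 ≤ t ^ s ∧ 1 ≤ t ^ p ∧ t ^ p ≤ t ∧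
      t ^ p ≤ (t ^ q) ^ 2 * t ^ s ∧ m t * t ^ q ≤ k₁ ∧ γ ≤ m t * (t ^ q * t ^ s) := by
    intro t ht
    obtain ⟨_, h2, h3, _⟩ := hT t ht
    have ht0 : 0 < t := by linarith
    obtain ⟨h4, h5⟩ := hA1 t ((le_max_left _ _).trans h2)
    refine ⟨one_le_rpow h3 hq0.le, one_le_rpow h3 hs.le, one_le_rpow h3 hp0.le, ?_, ?_, ?_, ?_⟩
    · simpa using rpow_le_rpow_of_exponent_le h3 hp1.le
    · rw [← rpow_mul_natCast ht0.le, ← rpow_add ht0]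
      refine rpow_le_rpow_of_exponent_le h3 ?_
      push_cast; linarith
    · rwa [le_div_iff₀ (rpow_pos_of_pos ht0 _)] at h5
    · rwa [div_le_iff₀ (rpow_pos_of_pos ht0 _), rpow_add ht0] at h4
  have hφ0 : ∀ t ≥ T, c / t ^ p / 2 * ‖x t - xt t‖ ^ 2 ≤ φ t := by
    intro t ht
    have h1 := hconv.add_inner_gradient_le (hf (xt t)) (x t)
    have h2 := congrArg (fun k => ⟪k, x t - xt t⟫) (hu t (hT t ht).1.le)
    simp only [inner_add_left, ContinuousLinearMap.adjoint_inner_left, inner_smul_left,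
      conj_trivial, inner_zero_left] at h2
    have h3 : ‖x t‖ ^ 2 - ‖xt t‖ ^ 2 = 2 * ⟪xt t, x t - xt t⟫ + ‖x t - xt t‖ ^ 2 := by
      rw [norm_sub_sq_real, inner_sub_right, real_inner_self_eq_norm_sq, real_inner_comm]; ring
    simp only [hφ_def]
    rw [h3]
    linarith
  have hcoef : ∀ t ≥ T, ∃ w' Θ', HasDerivAt w w' t ∧ HasDerivAt Θ Θ' t ∧
      t ^ q * t ^ s / 2 ≤ β t ∧ 1 / 2 ≤ w t ∧ w t ≤ 2 ∧
      |w'| ≤ k₁ * (1 + 3 * k₂) / t ^ 2 ∧ m t * ((t ^ q) ^ 2 * t ^ s) / 2 ≤ Θ t ∧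
      Θ t ≤ 3 * (m t * ((t ^ q) ^ 2 * t ^ s)) ∧ Θ' ≤ a * (t ^ q * t ^ s) / 4 := by
    intro t ht
    obtain ⟨h1, h2, h3, h4, h5, h6, -⟩ := hT t ht
    obtain ⟨p1, p2, -, -, -, p6, p7⟩ := hpow t ht
    obtain ⟨h8, h9⟩ := hA2 t ((le_max_right _ _).trans h2)
    have ht0 : 0 < t := by linarith
    have dR : HasDerivAt (fun τ : ℝ => τ ^ q) (q * t ^ q / t) t := by
      have := hasDerivAt_rpow_const (p := q) (Or.inl ht0.ne')
      rwa [rpow_sub_one ht0.ne', ← mul_div_assoc] at this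
    have dS : HasDerivAt (fun τ : ℝ => τ ^ s) (s * t ^ s / t) t := by
      have := hasDerivAt_rpow_const (p := s) (Or.inl ht0.ne')
      rwa [rpow_sub_one ht0.ne', ← mul_div_assoc] at this
    have dR2 : HasDerivAt Rd (q * (q - 1) * t ^ q / t ^ 2) t := by
      refine ((hasDerivAt_rpow_const (p := q - 1) (Or.inl ht0.ne')).const_mul q).congr_deriv ?_
      rw [rpow_sub_one ht0.ne', rpow_sub_one ht0.ne']
      field_simp
    have eRd : Rd t = q * t ^ q / t := by
      simp only [hRd_def]; rw [rpow_sub_one ht0.ne', mul_div_assoc]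
    have dm := hmd t h1.le
    have dm2 := hmd2 t h1.le
    have dw := ((hasDerivAt_const t (1 : ℝ)).fun_sub (dR2.fun_mul dm)).fun_sub (dm2.fun_mul dR)
    have dβ := (dR.fun_mul dS).fun_sub (dR2.const_mul γ)
    have dΘ := ((dR.fun_mul dm).fun_mul dβ).fun_add ((dR.const_mul γ).fun_mul dw)
    obtain ⟨b1, -, b3, b4, b5, b6, b7, b8⟩ := coefficient_bounds (a := a) (γ := γ) (q := q)
      (s := s) (k₁ := k₁) (k₂ := k₂) (t := t) (R := t ^ q) (S := t ^ s) (m := m t) (m₁ := m' t)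
      (m₂ := m'' t) (w := w t) (β := β t) hγ hq0 hq1 hs hk₁ hk₂ h3 p1 p2 (hmpos t h1.le) p6 p7
      h8 h9 h4 h5 (by rw [div_le_iff₀ ha] at h6; linarith)
      (by simp only [hβ_def, eRd]) (by simp only [hw_def, eRd]) rfl
    refine ⟨_, _, dw, dΘ, b1, b3, b4, ?_, b6, b7, ?_⟩
    · refine le_of_eq_of_le (congrArg abs ?_) b5
      rw [eRd]; ring
    · refine le_of_eq_of_le ?_ b8
      simp only [hw_def, hβ_def, eRd]; ring
  have hder : ∀ t > t₀, ‖xt' t‖ ≤ H / t ∧ ‖lt' t‖ ≤ H / t := by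
    intro t htt
    have ht : t₀ ≤ t := htt.le
    have ht0 : 0 < t := by linarith
    have hev : ∀ᶠ τ in 𝓝 t, t₀ ≤ τ := (lt_mem_nhds htt).mono fun _ h => h.le
    have h := norm_sq_deriv_regularized_saddle_le hf hconv hc ht0
      (hev.mono hu) (hev.mono hv) (hxt t ht) (hlt t ht)
    have h2 : ‖xt' t‖ ^ 2 + ‖lt' t‖ ^ 2 ≤ (H / t) ^ 2 := by
      calc _ ≤ (p / t) ^ 2 * (‖xt t‖ ^ 2 + ‖lt t‖ ^ 2) := h
        _ ≤ (1 / t) ^ 2 * H ^ 2 := by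
            gcongr
            exact hbd t ht
        _ = _ := by ring
    constructor <;> refine abs_le_of_sq_le_sq' ?_ (by positivity) |>.2
    · linarith [sq_nonneg ‖lt' t‖]
    · linarith [sq_nonneg ‖xt' t‖]
  have hEd : ∀ t ≥ T, ∃ D, HasDerivAt E D t ∧ D ≤ -(K / t ^ q) * E t
      + C * (m t * ((t ^ q) ^ 2 * t ^ s) * t ^ p / t ^ 2) := by
    intro t ht
    obtain ⟨h1, h2, h3, -, -, -, h7⟩ := hT t ht
    obtain ⟨p1, p2, p3, p4, p5, p6, p7⟩ := hpow t ht
    obtain ⟨w', Θ', dw, dΘ, b1, b3, b4, b5, b6, b7, b8⟩ := hcoef t ht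
    obtain ⟨n1, n2⟩ := hder t h1
    have ht0 : 0 < t := by linarith
    have hm0 := hmpos t h1.le
    have hS0 : 0 < t ^ s := by linarith
    have hR0 : 0 < t ^ q := by linarith
    have hV0 : 0 < t ^ p := by linarith
    have hβ0 : 0 < β t := lt_of_lt_of_le (by positivity) b1
    have hΘ0 : 0 ≤ Θ t := le_trans (by positivity) b6
    have hn : ‖xt t‖ ≤ H :=
      (abs_le_of_sq_le_sq' (by linarith [hbd t h1.le, sq_nonneg ‖lt t‖]) hH).2
    have dε : HasDerivAt (fun τ : ℝ => c / τ ^ p) (-(p / t) * (c / t ^ p)) t := by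
      refine ((hasDerivAt_const t c).fun_div (hasDerivAt_rpow_const (p := p)
        (Or.inl ht0.ne')) hV0.ne').congr_deriv ?_
      rw [rpow_sub_one ht0.ne']
      field_simp
      ring
    have dR : HasDerivAt (fun τ : ℝ => τ ^ q) (Rd t) t :=
      hasDerivAt_rpow_const (Or.inl ht0.ne')
    have eβ : t ^ (q + s) - γ * q * t ^ (q - 1) = β t := by
      simp only [hβ_def, hRd_def]; rw [rpow_add ht0]; ring
    have eΘ : m t * t ^ (2*q+s) + γ * t ^ q - 2 * m t * γ * q * t ^ (2*q-1)
        - γ * m' t * t ^ (2*q) = Θ t := by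
      simp only [hΘ_def, hβ_def, hw_def, hRd_def]
      rw [rpow_sub_one ht0.ne', rpow_sub_one ht0.ne', rpow_add ht0,
        show 2 * q = q * (2 : ℕ) by push_cast; ring, rpow_mul_natCast ht0.le]
      ring
    have hl : lam' t = (a * β t) • (A (x t) - b - (c / t ^ p) • lam t) + Θ t • A (x' t) := by
      have e : Θ t = a * β t * θ t := by
        rw [hθ, eβ, eΘ]; field_simp
      rw [hode2 t h1.le, eβ, e, map_add, map_smul, mul_smul _ (θ t), ← smul_add]
      congr 1; abel
    have hD := hasDerivAt_energy (ε := fun τ => c / τ ^ p) (R := fun τ => τ ^ q) hf ha_def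
      (hx t h1.le) (hx' t h1.le) (hgder t h1.le)
      (hxt t h1.le) (hlam t h1.le) (hlt t h1.le) dΘ dw dε dR (hmd t h1.le) hR0.ne' (hg t)
      (hu t h1.le) (hv t h1.le) (hode1 t h1.le) rfl rfl rfl hl
    refine ⟨_, hD, ?_⟩
    have hpert := perturbation_le (A := A) (u := x t) (x' := x' t) (g := g t)
      (e := lam t - lt t) ha hγ hc hp0 hp1.le ht0 p1 p3 hm0 p7 (by linarith) b4 hΘ0 b7 hn n1 n2
    have hG : φ t + c / t ^ p / 2 * ‖x t - xt t‖ ^ 2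
        ≤ ⟪f' (x t) + ContinuousLinearMap.adjoint A (lt t) + (c / t ^ p) • x t, x t - xt t⟫ := by
      have i1 := hconv.add_inner_gradient_le (hf (x t)) (xt t)
      have i2 : ‖x t‖ ^ 2 - ‖xt t‖ ^ 2 = 2 * ⟪x t, x t - xt t⟫ - ‖x t - xt t‖ ^ 2 := by
        rw [norm_sub_sq_real, inner_sub_right, real_inner_self_eq_norm_sq]; ring
      rw [← neg_sub (x t), inner_neg_right] at i1
      simp only [inner_add_left, ContinuousLinearMap.adjoint_inner_left, inner_smul_left,
        conj_trivial, hφ_def]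
      rw [i2]
      linarith
    have hw' : a / 2 * |w'| ≤ a * c / 16 * (t ^ q * t ^ s / t ^ p) := by
      have j1 : 8 * (k₁ * (1 + 3 * k₂)) ≤ t * c := (div_le_iff₀ hc).mp h7
      calc a / 2 * |w'| ≤ a / 2 * (k₁ * (1 + 3 * k₂) / t ^ 2) := by gcongr
        _ = a / 16 * (8 * (k₁ * (1 + 3 * k₂))) / t ^ 2 := by ring
        _ ≤ a / 16 * (t * c) / t ^ 2 := by gcongr
        _ = a * c / 16 * (1 * 1 / t) := by field_simp
        _ ≤ _ := by gcongr
    have hdis := dissipation_le (β := β t) (w := w t) (w' := w') (Θ := Θ t) (Θ' := Θ') (φ := φ t)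
      (V := t ^ p) (C₂ := a * H) (C₃ := a * γ * H) (C₄ := H) (C₁ := C₁)
      (ne := ‖lam t - lt t‖) ha hγ hc hk₁ h3 p1 p2 p3 p5 hm0 p6 p7
      b1 b3 b4 hw' b7 b8 (le_trans (by positivity) (hφ0 t ht)) hG hpert hK hK1 hK2 hK3 hK4 hK5
    have hvel := norm_sq_velocity_le (x t - xt t) (x' t) (g t) a γ (t ^ q) (m t)
    have hE2 : -(K / t ^ q) * (Θ t * φ t + 3 / 2 * (a ^ 2 * ‖x t - xt t‖ ^ 2
        + (t ^ q) ^ 2 * m t ^ 2 * ‖x' t‖ ^ 2 + γ ^ 2 * (t ^ q) ^ 2 * ‖g t‖ ^ 2)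
        + 1 / 2 * a * w t * ‖x t - xt t‖ ^ 2 + 1 / 2 * ‖lam t - lt t‖ ^ 2)
        ≤ -(K / t ^ q) * E t := by
      refine mul_le_mul_of_nonpos_left ?_ (neg_nonpos.mpr (by positivity))
      simp only [hE_def]
      linarith
    refine le_trans (le_of_eq ?_) (hdis.trans (add_le_add hE2 le_rfl))
    simp only [hφ_def]
    ring
  obtain ⟨M, hM, hE⟩ := le_of_deriv_energy_le (q := q) (s := s) (p := p) (m := m) (m' := m')
    (k₂ := k₂) (T := max T 1) (le_max_right _ _) hq1 hq0 hK hC hk₂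
    (fun t ht => hEd t ((le_max_left _ _).trans ht))
    (fun t ht => hmd t (hT t ((le_max_left _ _).trans ht)).1.le)
    (fun t ht => hmpos t (hT t ((le_max_left _ _).trans ht)).1.le)
    (fun t ht => (hA2 t ((le_max_right _ _).trans (hT t ((le_max_left _ _).trans ht)).2.1)).1)
  refine ⟨4 * M / a + 2 * M, by positivity, ?_⟩
  filter_upwards [hE, eventually_ge_atTop T] with t hEt ht
  obtain ⟨h1, h2, h3, -⟩ := hT t ht
  obtain ⟨p1, p2, p3, p4, p5, p6, p7⟩ := hpow t ht
  obtain ⟨w', Θ', -, -, b1, b3, b4, b5, b6, b7, b8⟩ := hcoef t ht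
  have ht0 : 0 < t := by linarith
  have hm0 := hmpos t h1.le
  have hS0 : 0 < t ^ s := by linarith
  have hR0 : 0 < t ^ q := by linarith
  have hV0 : 0 < t ^ p := by linarith
  have hφt : 0 ≤ φ t := le_trans (by positivity) (hφ0 t ht)
  have hΘ0 : 0 ≤ Θ t := le_trans (by positivity) b6
  have e0 : 0 ≤ Θ t * φ t := by positivity
  have e1 : 1 / 2 * a * (1 / 2 * ‖x t - xt t‖ ^ 2) ≤ 1 / 2 * a * (w t * ‖x t - xt t‖ ^ 2) := by
    gcongr
  have e1' : 0 ≤ 1 / 2 * a * (1 / 2 * ‖x t - xt t‖ ^ 2) := by positivity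
  have e2 : 0 ≤ 1 / 2 * ‖a • (x t - xt t) + t ^ q • (m t • x' t + γ • g t)‖ ^ 2 := by positivity
  have e3 : 0 ≤ 1 / 2 * ‖lam t - lt t‖ ^ 2 := by positivity
  simp only [hE_def] at hEt
  set Q := t ^ (4 * q + s + p - 2) with hQ
  have hQ0 : 0 < Q := rpow_pos_of_pos ht0 _
  have hMQ : 0 ≤ 4 * M / a * (m t * Q) := by positivity
  have hMQ' : 0 ≤ 2 * M * (m t * Q) := by positivity
  refine ⟨?_, ?_, ?_⟩
  · have hQe : Q = (t ^ q) ^ 2 * t ^ s * t ^ (2 * q + p - 2) := by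
      rw [hQ, ← rpow_mul_natCast ht0.le, ← rpow_add ht0, ← rpow_add ht0]
      congr 1; push_cast; ring
    have hP0 : 0 < t ^ (2 * q + p - 2) := rpow_pos_of_pos ht0 _
    set P := t ^ (2 * q + p - 2)
    have k1 : m t * ((t ^ q) ^ 2 * t ^ s) / 2 * φ t ≤ M * (m t * Q) :=
      (mul_le_mul_of_nonneg_right b6 hφt).trans (by linarith)
    rw [hQe] at k1
    have k2 : φ t ≤ 2 * M * P := by
      have hN : 0 < m t * ((t ^ q) ^ 2 * t ^ s) := by positivity
      refine le_of_mul_le_mul_left ?_ hN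
      linarith
    have k3 : 0 ≤ 4 * M / a * P := by positivity
    change φ t ≤ _
    linarith
  · have k : ‖x t - xt t‖ ^ 2 ≤ 4 * M / a * (m t * Q) := by
      rw [div_mul_eq_mul_div, le_div_iff₀ ha]
      linarith
    linarith
  · linarith

lemma abs_real_inner_le_mul {E : Type*} [NormedAddCommGroup E] [InnerProductSpace ℝ E] {y z : E}
    {h k : ℝ} (hy : ‖y‖ ≤ h) (hz : ‖z‖ ≤ k) : |⟪y, z⟫| ≤ h * k :=
  (abs_real_inner_le_norm _ _).trans
    (mul_le_mul hy hz (norm_nonneg _) ((norm_nonneg _).trans hy))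

/-- A primal point whose regularized gap and distance to the regularized saddle point `(v, l)` are
small is almost feasible and almost optimal for the unregularized problem. -/
lemma feasibility_and_value_le {f : X → ℝ} {f' : X → X} (hf : ∀ u, HasGradientAt f (f' u) u)
    (hconv : ConvexOn ℝ Set.univ f) {A : X →L[ℝ] Y} {b : Y} {xs u v : X} {ls l : Y}
    {c H M N r₁ r₂ : ℝ} (hc : 0 < c) (hN : 0 ≤ N) (hM : 0 ≤ M)
    (hr₁ : 0 ≤ r₁) (hr₂ : 0 ≤ r₂) (hr₂1 : r₂ ≤ 1)
    (hfeas : A xs = b) (hls : ∀ u, f xs ≤ f u + ⟪ls, A u - b⟫)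
    (hxsH : ‖xs‖ ≤ H) (hlsH : ‖ls‖ ≤ H) (hvH : ‖v‖ ≤ H) (hlH : ‖l‖ ≤ H)
    (hu : f' v + ContinuousLinearMap.adjoint A l + (c * r₂) • v = 0)
    (hv : A v - b - (c * r₂) • l = 0) (hd : ‖u - v‖ ≤ N * r₁)
    (hφ : f u - f v + ⟪l, A (u - v)⟫ + c * r₂ / 2 * (‖u‖ ^ 2 - ‖v‖ ^ 2) ≤ M * r₂) :
    ‖A u - b‖ ≤ (‖A‖ * N + c * H) * (r₁ + r₂) ∧
    |f u - f xs| ≤ (M + H * ‖A‖ * N + 2 * c * H ^ 2 + c * H * N) * (r₁ + r₂) := by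
  have hH : 0 ≤ H := (norm_nonneg _).trans hxsH
  have hA : ‖A (u - v)‖ ≤ ‖A‖ * (N * r₁) := (A.le_opNorm _).trans (by gcongr)
  have hv' : A v - b = (c * r₂) • l := sub_eq_zero.mp hv
  obtain ⟨a1, a2⟩ := abs_le.mp (abs_real_inner_le_mul hlH hA)
  obtain ⟨a3, a4⟩ := abs_le.mp (abs_real_inner_le_mul hvH hd)
  obtain ⟨a5, a6⟩ := abs_le.mp (abs_real_inner_le_mul hvH hxsH)
  obtain ⟨a7, a8⟩ := abs_le.mp (abs_real_inner_le_mul hlsH hlH)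
  have n1 : 0 ≤ ‖A‖ * N * r₂ := by positivity
  have n2 : 0 ≤ c * H * r₁ := by positivity
  have hcr : 0 ≤ c * r₂ := by positivity
  refine ⟨?_, ?_⟩
  · have e : A u - b = A (u - v) + (c * r₂) • l := by rw [← hv', map_sub]; abel
    calc ‖A u - b‖ ≤ ‖A‖ * (N * r₁) + c * r₂ * H := by
          rw [e]
          refine (norm_add_le _ _).trans (add_le_add hA ?_)
          rw [norm_smul, norm_of_nonneg hcr]
          gcongr
      _ ≤ _ := by linarith
  · have b1 : f u - f v ≤ M * r₂ + H * ‖A‖ * N * r₁ + c * H ^ 2 * r₂ := by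
      have h1 : ‖v‖ ^ 2 ≤ H ^ 2 := by gcongr
      have h2 : -(c * r₂ / 2 * (‖u‖ ^ 2 - ‖v‖ ^ 2)) ≤ c * H ^ 2 * r₂ := by
        calc _ = c * r₂ / 2 * (‖v‖ ^ 2 - ‖u‖ ^ 2) := by ring
          _ ≤ c * r₂ / 2 * (H ^ 2 + H ^ 2) := by
              gcongr
              linarith [sq_nonneg ‖u‖, sq_nonneg H]
          _ = _ := by ring
      linarith
    have hg : ∀ k, ⟪f' v, k⟫ = -⟪l, A k⟫ - c * r₂ * ⟪v, k⟫ := fun k => by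
      have := congrArg (fun z => ⟪z, k⟫) hu
      simp only [inner_add_left, ContinuousLinearMap.adjoint_inner_left, inner_smul_left,
        conj_trivial, inner_zero_left] at this
      linarith
    have b2 : -(H * ‖A‖ * N * r₁ + c * H * N * r₁) ≤ f u - f v := by
      have h1 := hconv.add_inner_gradient_le (hf v) u
      rw [hg] at h1
      have h2 : c * r₂ * ⟪v, u - v⟫ ≤ c * 1 * (H * (N * r₁)) := by
        calc _ ≤ c * r₂ * (H * (N * r₁)) := by gcongr
          _ ≤ _ := by gcongr
      linarith
    have b3 : f v - f xs ≤ c * H ^ 2 * r₂ := by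
      have h1 := hconv.add_inner_gradient_le (hf v) xs
      have h2 : A (xs - v) = -((c * r₂) • l) := by rw [← hv', map_sub, hfeas]; abel
      rw [hg, h2, inner_neg_right, inner_smul_right, inner_sub_right,
        real_inner_self_eq_norm_sq, real_inner_self_eq_norm_sq] at h1
      have h3 : c * r₂ * ⟪v, xs⟫ ≤ c * r₂ * (H * H) := by gcongr
      have h4 : 0 ≤ c * r₂ * ‖l‖ ^ 2 := by positivity
      have h5 : 0 ≤ c * r₂ * ‖v‖ ^ 2 := by positivity
      linarith
    have b4 : -(c * H ^ 2 * r₂) ≤ f v - f xs := by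
      have h1 := hls v
      rw [hv', inner_smul_right] at h1
      have h3 : c * r₂ * ⟪ls, l⟫ ≤ c * r₂ * (H * H) := by gcongr
      linarith
    have n3 : 0 ≤ M * r₁ := by positivity
    have n4 : 0 ≤ M * r₂ := by positivity
    have n5 : 0 ≤ H * ‖A‖ * N * r₁ := by positivity
    have n6 : 0 ≤ H * ‖A‖ * N * r₂ := by positivity
    have n7 : 0 ≤ c * H ^ 2 * r₁ := by positivity
    have n8 : 0 ≤ c * H ^ 2 * r₂ := by positivity
    have n9 : 0 ≤ c * H * N * r₁ := by positivity
    have n10 : 0 ≤ c * H * N * r₂ := by positivity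
    rw [abs_le]
    constructor <;> linarith

end EnergyDecay

theorem rates_large_p_subcase_one
    {X Y : Type*} [NormedAddCommGroup X] [InnerProductSpace ℝ X] [CompleteSpace X]
    [NormedAddCommGroup Y] [InnerProductSpace ℝ Y] [CompleteSpace Y]
    (f : X → ℝ) (f' : X → X) (hf : ∀ u, HasGradientAt f (f' u) u)
    (hconv : ConvexOn ℝ Set.univ f)
    (A : X →L[ℝ] Y) (b : Y)
    (L : X → Y → ℝ) (hL : ∀ u lam, L u lam = f u + ⟪lam, A u - b⟫)
    (c p t₀ : ℝ) (hc : 0 < c) (hp0 : 0 < p) (hp1 : p < 1) (ht₀ : 0 < t₀)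
    (Lt : ℝ → X → Y → ℝ)
    (hLt : ∀ t u lam, Lt t u lam = L u lam + (c / (2 * t ^ p)) * (‖u‖ ^ 2 - ‖lam‖ ^ 2))
    (gx : ℝ → X → Y → X)
    (hgx : ∀ t u lam, gx t u lam = f' u + ContinuousLinearMap.adjoint A lam + (c / t ^ p) • u)
    (gl : ℝ → X → Y → Y)
    (hgl : ∀ t u lam, gl t u lam = A u - b - (c / t ^ p) • lam)
    (Om : Set (X × Y))
    (hOm : Om = {z : X × Y | ∀ u μ, L z.1 μ ≤ L z.1 z.2 ∧ L z.1 z.2 ≤ L u z.2})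
    (hOmne : Om.Nonempty)
    (xs : X) (ls : Y)
    (hmem : (xs, ls) ∈ Om)
    (hmin : ∀ w ∈ Om, Real.sqrt (‖xs‖ ^ 2 + ‖ls‖ ^ 2) ≤ Real.sqrt (‖w.1‖ ^ 2 + ‖w.2‖ ^ 2))
    (α q γ s : ℝ) (hα : 1 < α) (hq0 : 0 < q) (hq1 : q < 1) (hγ : 0 < γ) (hs : 0 < s)
    (m m' m'' : ℝ → ℝ)
    (hmpos : ∀ t ≥ t₀, 0 < m t)
    (hmmono : AntitoneOn m (Set.Ici t₀))
    (hmd : ∀ t ≥ t₀, HasDerivAt m (m' t) t)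
    (hmd2 : ∀ t ≥ t₀, HasDerivAt m' (m'' t) t)
    (θ : ℝ → ℝ)
    (hθ : ∀ t, θ t = (m t * t ^ (2*q+s) + γ * t ^ q - 2 * m t * γ * q * t ^ (2*q-1)
      - γ * m' t * t ^ (2*q)) / ((α - 1) * (t ^ (q+s) - γ * q * t ^ (q-1))))
    (k₁ k₂ T₁ T₂ : ℝ) (hk₁ : 0 < k₁) (hk₂ : 0 < k₂) (hT₁ : t₀ ≤ T₁) (hT₂ : t₀ ≤ T₂)
    (hA1 : ∀ t ≥ T₁, γ / t ^ (q+s) ≤ m t ∧ m t ≤ k₁ / t ^ q)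
    (hA2 : ∀ t ≥ T₂, t * |m' t| ≤ k₂ * m t ∧ t ^ 2 * |m'' t| ≤ k₂ * m t)
    (x : ℝ → X) (lam : ℝ → Y) (x' x'' : ℝ → X) (lam' : ℝ → Y) (gder : ℝ → X)
    (hx : ∀ t ≥ t₀, HasDerivAt x (x' t) t)
    (hx' : ∀ t ≥ t₀, HasDerivAt x' (x'' t) t)
    (hx''c : ContinuousOn x'' (Set.Ici t₀))
    (hlam : ∀ t ≥ t₀, HasDerivAt lam (lam' t) t)
    (hlamc : ContinuousOn lam' (Set.Ici t₀))
    (hgder : ∀ t ≥ t₀, HasDerivAt (fun τ => gx τ (x τ) (lam τ)) (gder t) t)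
    (hode1 : ∀ t ≥ t₀, m t • x'' t + (α / t ^ q) • x' t + γ • gder t
      + t ^ s • gx t (x t) (lam t) = 0)
    (hode2 : ∀ t ≥ t₀, lam' t = ((α - 1) * (t ^ (q+s) - γ * q * t ^ (q-1)))
      • gl t (x t + θ t • x' t) (lam t))
    (xt : ℝ → X) (lt : ℝ → Y)
    (hsaddle : ∀ t ≥ t₀, gx t (xt t) (lt t) = 0 ∧ gl t (xt t) (lt t) = 0)
    (xt' : ℝ → X) (lt' : ℝ → Y)
    (hxt : ∀ t ≥ t₀, HasDerivAt xt (xt' t) t)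
    (hlt : ∀ t ≥ t₀, HasDerivAt lt (lt' t) t)
    (hxtc : ContinuousOn xt' (Set.Ici t₀))
    (hltc : ContinuousOn lt' (Set.Ici t₀))
    (hqs1 : (1 - q)/2 ≤ 2*q + s) (hqs2 : 2*q + s < 1 - q)
    (hcond1 : 4*q + s + p - 2 < 0) (hp2 : (1 - q)/2 < p) (hp3 : p < 2*q + s)
    :
    ((fun t => L (x t) ls - L xs ls) =O[atTop]
        (fun t => Real.sqrt (m t) * t ^ ((4*q+s+p-2)/2) + t ^ (-p)))
    ∧ ((fun t => |f (x t) - f xs|) =O[atTop]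
        (fun t => Real.sqrt (m t) * t ^ ((4*q+s+p-2)/2) + t ^ (-p)))
    ∧ ((fun t => ‖A (x t) - b‖) =O[atTop]
        (fun t => Real.sqrt (m t) * t ^ ((4*q+s+p-2)/2) + t ^ (-p)))
    ∧ ((fun t => ‖x t - xt t‖ ^ 2 + ‖lam t - lt t‖ ^ 2) =O[atTop]
        (fun t => m t * t ^ (4*q+s+p-2))) := by
  rw [hOm] at hmem
  have hfeas : A xs = b := by
    have h := (hmem 0 (ls + (A xs - b))).1
    simp only [hL, inner_add_left, real_inner_self_eq_norm_sq] at h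
    rw [← sub_eq_zero, ← norm_eq_zero, ← sq_eq_zero_iff]
    exact le_antisymm (by linarith) (sq_nonneg _)
  have hls : ∀ u, f xs ≤ f u + ⟪ls, A u - b⟫ := fun u => by
    have h := (hmem u ls).2
    simpa only [hL, hfeas, sub_self, inner_zero_right, add_zero] using h
  have hu : ∀ t ≥ t₀, f' (xt t) + ContinuousLinearMap.adjoint A (lt t) + (c / t ^ p) • xt t = 0 :=
    fun t ht => by rw [← hgx]; exact (hsaddle t ht).1
  have hv : ∀ t ≥ t₀, A (xt t) - b - (c / t ^ p) • lt t = 0 :=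
    fun t ht => by rw [← hgl]; exact (hsaddle t ht).2
  set H := √(‖xs‖ ^ 2 + ‖ls‖ ^ 2) with hH_def
  have hH : 0 ≤ H := sqrt_nonneg _
  have hH2 : H ^ 2 = ‖xs‖ ^ 2 + ‖ls‖ ^ 2 := sq_sqrt (by positivity)
  have hbd : ∀ t ≥ t₀, ‖xt t‖ ^ 2 + ‖lt t‖ ^ 2 ≤ H ^ 2 := fun t ht => by
    rw [hH2]
    have : 0 < c / t ^ p := div_pos hc (rpow_pos_of_pos (ht₀.trans_le ht) _)
    exact norm_sq_regularized_saddle_le hf hconv this hfeas hls (hu t ht) (hv t ht)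
  obtain ⟨M, hM, hev⟩ := regularized_gap_decay hf hconv hc hp0 hp1 ht₀ hα hq0 hq1 hγ hs hmpos hmd
    hmd2 hθ hk₁ hk₂ hA1 hA2 hx hx' hlam (fun t => hgx t (x t) (lam t)) hgder hode1
    (fun t ht => by rw [hode2 t ht, hgl]) hu hv hxt hlt hH hbd hp3
  have hnorm : ∀ {y z : ℝ}, y ^ 2 + z ^ 2 ≤ H ^ 2 → y ≤ H ∧ z ≤ H := fun {y z} h =>
    ⟨(abs_le_of_sq_le_sq' (by linarith [sq_nonneg z]) hH).2,
      (abs_le_of_sq_le_sq' (by linarith [sq_nonneg y]) hH).2⟩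
  have hmain : ∀ᶠ t in atTop,
      ‖A (x t) - b‖ ≤ (‖A‖ * √M + c * H) * (√(m t) * t ^ ((4*q+s+p-2)/2) + t ^ (-p)) ∧
      |f (x t) - f xs| ≤ (M + H * ‖A‖ * √M + 2 * c * H ^ 2 + c * H * √M)
        * (√(m t) * t ^ ((4*q+s+p-2)/2) + t ^ (-p)) := by
    filter_upwards [hev, eventually_ge_atTop t₀, eventually_ge_atTop 1] with t ht htt ht1
    have ht0 : 0 < t := by linarith
    have hε : c / t ^ p = c * t ^ (-p) := by rw [rpow_neg ht0.le, div_eq_mul_inv]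
    obtain ⟨h1, h2, -⟩ := ht
    have hut := hu t htt
    have hvt := hv t htt
    rw [hε] at h1 hut hvt
    obtain ⟨n1, n2⟩ := hnorm (hbd t htt)
    obtain ⟨n3, n4⟩ := hnorm hH2.ge
    have hd : ‖x t - xt t‖ ≤ √M * (√(m t) * t ^ ((4*q+s+p-2)/2)) := by
      have := le_sqrt_of_sq_le h2
      rwa [sqrt_mul hM.le, sqrt_mul (hmpos t htt).le, sqrt_eq_rpow (t ^ _), ← rpow_mul ht0.le,
        mul_one_div] at this
    have hr : t ^ (2 * q + p - 2) ≤ t ^ (-p) := rpow_le_rpow_of_exponent_le ht1 (by linarith)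
    exact feasibility_and_value_le hf hconv hc (sqrt_nonneg _) hM.le
      (mul_nonneg (sqrt_nonneg _) (rpow_nonneg ht0.le _)) (rpow_nonneg ht0.le _)
      (rpow_le_one_of_one_le_of_nonpos ht1 (by linarith)) hfeas hls n3 n4 n1 n2 hut hvt hd
      (h1.trans (by gcongr))
  refine ⟨?_, ?_, ?_, ?_⟩
  · refine IsBigO.of_bound ((M + H * ‖A‖ * √M + 2 * c * H ^ 2 + c * H * √M)
      + H * (‖A‖ * √M + c * H)) ?_
    filter_upwards [hmain] with t ht
    rw [hL, hL, hfeas, sub_self, inner_zero_right, add_zero, add_sub_right_comm]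
    refine (norm_add_le _ _).trans ?_
    rw [norm_eq_abs, norm_eq_abs, add_mul, mul_assoc H (_ + _)]
    exact add_le_add (ht.2.trans (mul_le_mul_of_nonneg_left (le_abs_self _) (by positivity)))
      (abs_real_inner_le_mul (hnorm hH2.ge).2
        (ht.1.trans (mul_le_mul_of_nonneg_left (le_abs_self _) (by positivity))))
  · refine IsBigO.of_bound (M + H * ‖A‖ * √M + 2 * c * H ^ 2 + c * H * √M)
      (hmain.mono fun t ht => ?_)
    rw [norm_eq_abs, abs_abs]
    exact ht.2.trans (mul_le_mul_of_nonneg_left (le_abs_self _) (by positivity))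
  · refine IsBigO.of_bound (‖A‖ * √M + c * H) (hmain.mono fun t ht => ?_)
    rw [norm_norm]
    exact ht.1.trans (mul_le_mul_of_nonneg_left (le_abs_self _) (by positivity))
  · refine IsBigO.of_bound (M + M) (hev.mono fun t ht => ?_)
    rw [norm_of_nonneg (by positivity), add_mul]
    exact add_le_add (ht.2.1.trans (mul_le_mul_of_nonneg_left (le_abs_self _) hM.le))
      (ht.2.2.trans (mul_le_mul_of_nonneg_left (le_abs_self _) hM.le))
end

section
/- Suppose Assumptions A1 and A2 hold, (1−q)/2 ≤ 2q + s < 1 − q, 4q + s + p − 2 < 0, and 2q + s ≤ p < 1 − q. Let (x,λ) be a global solution of the dynamical system, let (x_t,λ_t) be the unique saddle point of L_t with t ↦ (x_t,λ_t) continuously differentiable, and let (x*,λ*) be the projection of the origin onto Ω. Then, as t → +∞: L(x(t),λ*) − L(x*,λ*) = O(√(m(t)) t^{q+p−1} + t^{−p}), |f(x(t)) − f(x*)| = O(√(m(t)) t^{q+p−1} + t^{−p}), ‖Ax(t) − b‖ = O(√(m(t)) t^{q+p−1} + t^{−p}), and ‖(x(t)−x_t, λ(t)−λ_t)‖² = O(m(t)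 t^{2q+2p−2}). -/
open Real Filter Asymptotics
open scoped RealInnerProductSpace Topology

/-- A differential inequality `E' ≤ -K ρ E + C ρ W` with a slowly varying weight `W` forces
`E = O(W)`. -/
lemma exists_forall_le_mul_of_deriv_le {E E' W W' ρ : ℝ → ℝ} {T K C C' : ℝ} (hK : 0 < K)
    (hC : 0 ≤ C) (hE : ∀ t ≥ T, HasDerivAt E (E' t) t) (hW : ∀ t ≥ T, HasDerivAt W (W' t) t)
    (hWpos : ∀ t ≥ T, 0 < W t) (hρ : ∀ t ≥ T, 0 < ρ t)
    (hE' : ∀ t ≥ T, E' t ≤ -(K * ρ t * E t) + C * (ρ t * W t))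
    (hW' : ∀ t ≥ T, -(C' / t * W t) ≤ W' t) (hC' : ∀ t ≥ T, C' / t ≤ K / 2 * ρ t) :
    ∃ M, 0 < M ∧ ∀ t ≥ T, E t ≤ M * W t := by
  set M := max (E T / W T) (2 * C / K + 1) with hM
  have hMC : 2 * C / K < M := lt_of_lt_of_le (lt_add_one _) (le_max_right _ _)
  have hMpos : 0 < M := lt_of_le_of_lt (by positivity) hMC
  refine ⟨M, hMpos, fun t ht => ?_⟩
  have hCM : 2 * C < M * K := by rwa [div_lt_iff₀ hK] at hMC
  refine image_le_of_deriv_right_lt_deriv_boundary' (f := E) (f' := E') (a := T) (b := t)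
    (B := fun t => M * W t) (B' := fun t => M * W' t)
    (fun r hr => (hE r hr.1).continuousAt.continuousWithinAt)
    (fun r hr => (hE r hr.1).hasDerivWithinAt) ?_
    (fun r hr => ((hW r hr.1).const_mul M).continuousAt.continuousWithinAt)
    (fun r hr => ((hW r hr.1).const_mul M).hasDerivWithinAt) ?_ ⟨ht, le_rfl⟩
  · rw [← div_le_iff₀ (hWpos T le_rfl)]
    exact le_max_left _ _
  · intro r hr hEr
    have h1 := hE' r hr.1
    have h2 := mul_le_mul_of_nonneg_left (hW' r hr.1) hMpos.le
    have h3 := mul_le_mul_of_nonneg_right (hC' r hr.1) (mul_pos hMpos (hWpos r hr.1)).le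
    have h4 := mul_pos (hρ r hr.1) (hWpos r hr.1)
    rw [hEr] at h1
    nlinarith

section Tikhonov

variable {X Y : Type*} [NormedAddCommGroup X] [InnerProductSpace ℝ X] [CompleteSpace X]
  [NormedAddCommGroup Y] [InnerProductSpace ℝ Y] [CompleteSpace Y]
  {f : X → ℝ} {f' : X → X} {A : X →L[ℝ] Y} {b : Y}

/-- Norm bound for the saddle point `(y, l)` of the `ε`-regularized Lagrangian, in terms of any
saddle point `(xs, ls)` of the Lagrangian, together with the value gap. -/
lemma regularized_saddle_bounds (hf : ∀ u, HasGradientAt f (f' u) u)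
    (hconv : ConvexOn ℝ Set.univ f) {xs : X} {ls : Y} (hfeas : A xs = b)
    (hmin : ∀ u, f xs ≤ f u + ⟪ls, A u - b⟫) {ε : ℝ} (hε : 0 < ε) {y : X} {l : Y}
    (hy : f' y + ContinuousLinearMap.adjoint A l + ε • y = 0) (hl : A y - b - ε • l = 0) :
    ‖y‖ ^ 2 + ‖l‖ ^ 2 ≤ ‖xs‖ ^ 2 + ‖ls‖ ^ 2 ∧
      |f y - f xs| ≤ ε * (2 * (‖xs‖ ^ 2 + ‖ls‖ ^ 2)) := by
  have h1 := hconv.add_inner_gradient_le (hf y) xs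
  have h2 := hmin y
  have hf'y : f' y = -(ContinuousLinearMap.adjoint A l) - ε • y := by
    rw [eq_sub_iff_add_eq, eq_neg_iff_add_eq_zero, ← hy]; abel
  have hAy : A y - b = ε • l := sub_eq_zero.mp hl
  have hA : A (xs - y) = -(ε • l) := by rw [map_sub, hfeas, ← hAy]; abel
  rw [hf'y, inner_sub_left, inner_neg_left, ContinuousLinearMap.adjoint_inner_left, hA,
    inner_neg_right, inner_smul_right, inner_smul_left, inner_sub_right,
    real_inner_self_eq_norm_sq, real_inner_self_eq_norm_sq] at h1
  rw [hAy, inner_smul_right] at h2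
  simp only [conj_trivial] at h1
  have h3 := real_inner_le_norm y xs
  have h4 := real_inner_le_norm ls l
  have h5 := two_mul_le_add_sq ‖y‖ ‖xs‖
  have h6 := two_mul_le_add_sq ‖ls‖ ‖l‖
  have h7 : ‖y‖ ^ 2 + ‖l‖ ^ 2 ≤ ⟪y, xs⟫ + ⟪ls, l⟫ := by
    have : ε * (‖y‖ ^ 2 + ‖l‖ ^ 2) ≤ ε * (⟪y, xs⟫ + ⟪ls, l⟫) := by linarith
    exact le_of_mul_le_mul_left this hε
  have h8 : ‖y‖ ^ 2 + ‖l‖ ^ 2 ≤ ‖xs‖ ^ 2 + ‖ls‖ ^ 2 := by linarith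
  refine ⟨h8, ?_⟩
  have h9 : ε * ⟪y, xs⟫ ≤ ε * (‖xs‖ ^ 2 + ‖ls‖ ^ 2) :=
    mul_le_mul_of_nonneg_left (by nlinarith [sq_nonneg ‖l‖, sq_nonneg ‖ls‖]) hε.le
  have h10 : ε * ⟪ls, l⟫ ≤ ε * (‖xs‖ ^ 2 + ‖ls‖ ^ 2) :=
    mul_le_mul_of_nonneg_left (by nlinarith [sq_nonneg ‖y‖, sq_nonneg ‖xs‖]) hε.le
  have h11 : 0 ≤ ε * (‖xs‖ ^ 2 + ‖ls‖ ^ 2) := by positivity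
  have h12 : 0 ≤ ε * ‖l‖ ^ 2 := by positivity
  have h13 : 0 ≤ ε * ‖y‖ ^ 2 := by positivity
  rw [abs_le]
  constructor <;> linarith

/-- Lipschitz dependence of the regularized saddle point on the regularization parameter. -/
lemma regularized_saddle_lipschitz (hf : ∀ u, HasGradientAt f (f' u) u)
    (hconv : ConvexOn ℝ Set.univ f) {ε η : ℝ} (hε : 0 < ε) {y z : X} {l k : Y} {R : ℝ} (hR : 0 ≤ R)
    (hy : f' y + ContinuousLinearMap.adjoint A l + ε • y = 0) (hl : A y - b - ε • l = 0)
    (hz : f' z + ContinuousLinearMap.adjoint A k + η • z = 0) (hk : A z - b - η • k = 0)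
    (hzR : ‖z‖ ^ 2 + ‖k‖ ^ 2 ≤ R ^ 2) :
    ‖z - y‖ ≤ R / ε * |η - ε| ∧ ‖k - l‖ ≤ R / ε * |η - ε| := by
  have h1 := hconv.add_inner_gradient_le (hf y) z
  have h2 := hconv.add_inner_gradient_le (hf z) y
  have hf'y : f' y = -(ContinuousLinearMap.adjoint A l) - ε • y := by
    rw [eq_sub_iff_add_eq, eq_neg_iff_add_eq_zero, ← hy]; abel
  have hf'z : f' z = -(ContinuousLinearMap.adjoint A k) - η • z := by
    rw [eq_sub_iff_add_eq, eq_neg_iff_add_eq_zero, ← hz]; abel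
  have hA : A (z - y) = η • k - ε • l := by
    rw [map_sub, ← sub_eq_zero.mp hl, ← sub_eq_zero.mp hk]; abel
  have hA' : A (y - z) = -(η • k - ε • l) := by
    rw [← hA, ← map_neg, neg_sub]
  rw [hf'y, inner_sub_left, inner_neg_left, ContinuousLinearMap.adjoint_inner_left, hA] at h1
  rw [hf'z, inner_sub_left, inner_neg_left, ContinuousLinearMap.adjoint_inner_left, hA'] at h2
  have hmain : ε * (‖z - y‖ ^ 2 + ‖k - l‖ ^ 2) ≤ -(η - ε) * (⟪z, z - y⟫ + ⟪k, k - l⟫) := by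
    rw [← real_inner_self_eq_norm_sq, ← real_inner_self_eq_norm_sq]
    simp only [inner_sub_left, inner_sub_right, inner_smul_left, inner_smul_right,
      inner_neg_right, conj_trivial] at h1 h2 ⊢
    rw [real_inner_comm y z, real_inner_comm k l] at *
    linarith
  set a := ‖z - y‖
  set d := ‖k - l‖
  have ha : 0 ≤ a := norm_nonneg _
  have hd : 0 ≤ d := norm_nonneg _
  set D := Real.sqrt (a ^ 2 + d ^ 2) with hD
  have hD2 : D ^ 2 = a ^ 2 + d ^ 2 := Real.sq_sqrt (by positivity)
  have hD0 : 0 ≤ D := Real.sqrt_nonneg _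
  have hcs : |⟪z, z - y⟫ + ⟪k, k - l⟫| ≤ R * D := by
    have e1 := abs_real_inner_le_norm z (z - y)
    have e2 := abs_real_inner_le_norm k (k - l)
    refine (abs_add_le _ _).trans ((add_le_add e1 e2).trans ?_)
    refine abs_le_of_sq_le_sq' ?_ (by positivity) |>.2
    have : (R * D) ^ 2 = R ^ 2 * (a ^ 2 + d ^ 2) := by rw [mul_pow, hD2]
    rw [this]
    nlinarith [sq_nonneg (‖z‖ * d - ‖k‖ * a), mul_le_mul_of_nonneg_right hzR
      (by positivity : 0 ≤ a ^ 2 + d ^ 2)]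
  have hbound : ε * D ^ 2 ≤ |η - ε| * (R * D) := by
    rw [hD2]
    refine hmain.trans ((le_abs_self _).trans ?_)
    rw [abs_mul, abs_neg]
    exact mul_le_mul_of_nonneg_left hcs (abs_nonneg _)
  have hDle : D ≤ R / ε * |η - ε| := by
    rcases hD0.eq_or_lt with h | h
    · rw [← h]; positivity
    · have : ε * D ≤ R * |η - ε| := by
        refine le_of_mul_le_mul_right ?_ h
        nlinarith
      rw [div_mul_eq_mul_div, le_div_iff₀ hε]
      linarith
  exact ⟨(Real.le_sqrt_of_sq_le (by nlinarith [sq_nonneg d])).trans hDle,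
    (Real.le_sqrt_of_sq_le (by nlinarith [sq_nonneg a])).trans hDle⟩

end Tikhonov

/-- A curve whose increments at `t` are controlled by those of a scalar function has its
derivative controlled by that of the scalar function. -/
lemma HasDerivAt.norm_le_mul_abs_of_eventually {V : Type*} [NormedAddCommGroup V]
    [NormedSpace ℝ V] {y : ℝ → V} {y' : V} {ε : ℝ → ℝ} {ε' t K : ℝ} (hy : HasDerivAt y y' t)
    (hε : HasDerivAt ε ε' t) (h : ∀ᶠ r in 𝓝 t, ‖y r - y t‖ ≤ K * |ε r - ε t|) :
    ‖y'‖ ≤ K * |ε'| := by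
  refine le_of_tendsto_of_tendsto (hasDerivAt_iff_tendsto_slope.mp hy).norm
    ((hasDerivAt_iff_tendsto_slope.mp hε).abs.const_mul K) ?_
  filter_upwards [h.filter_mono nhdsWithin_le_nhds] with r hr
  rw [slope_def_module, slope_def_field, norm_smul, abs_div, norm_inv, Real.norm_eq_abs,
    inv_mul_eq_div, ← mul_div_assoc]
  exact div_le_div_of_nonneg_right hr (abs_nonneg _)

section Energy

variable {X Y : Type*} [NormedAddCommGroup X] [InnerProductSpace ℝ X] [CompleteSpace X]
  [NormedAddCommGroup Y] [InnerProductSpace ℝ Y] {f : X → ℝ} {f' : X → X} {A : X →L[ℝ] Y} {b : Y}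

/-- Chain rule for the energy functional along a trajectory. -/
lemma energy_hasDerivAt (hf : ∀ u, HasGradientAt f (f' u) u) {x y v G : ℝ → X} {lam l : ℝ → Y}
    {δ μ κ g ε : ℝ → ℝ} {x₁ y₁ v₁ G₁ : X} {lam₁ l₁ : Y} {δ₁ μ₁ κ₁ g₁ ε₁ a t : ℝ}
    (hx : HasDerivAt x x₁ t) (hy : HasDerivAt y y₁ t) (hv : HasDerivAt v v₁ t)
    (hG : HasDerivAt G G₁ t) (hlam : HasDerivAt lam lam₁ t) (hl : HasDerivAt l l₁ t)
    (hδ : HasDerivAt δ δ₁ t) (hμ : HasDerivAt μ μ₁ t) (hκ : HasDerivAt κ κ₁ t)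
    (hg : HasDerivAt g g₁ t) (hε : HasDerivAt ε ε₁ t) :
    HasDerivAt (fun r => δ r * (f (x r) - f (y r) + ⟪l r, A (x r - y r)⟫
        + ε r / 2 * (‖x r‖ ^ 2 - ‖y r‖ ^ 2))
        + ‖a • (x r - y r) + μ r • v r + g r • G r‖ ^ 2 / 2
        + a / 2 * (κ r * ‖x r - y r‖ ^ 2) + ‖lam r - l r‖ ^ 2 / 2)
      (δ₁ * (f (x t) - f (y t) + ⟪l t, A (x t - y t)⟫ + ε t / 2 * (‖x t‖ ^ 2 - ‖y t‖ ^ 2))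
        + δ t * (⟪f' (x t), x₁⟫ - ⟪f' (y t), y₁⟫
          + (⟪l t, A (x₁ - y₁)⟫ + ⟪l₁, A (x t - y t)⟫)
          + (ε₁ / 2 * (‖x t‖ ^ 2 - ‖y t‖ ^ 2) + ε t * (⟪x t, x₁⟫ - ⟪y t, y₁⟫)))
        + ⟪a • (x t - y t) + μ t • v t + g t • G t,
            a • (x₁ - y₁) + (μ t • v₁ + μ₁ • v t) + (g t • G₁ + g₁ • G t)⟫
        + a / 2 * (κ₁ * ‖x t - y t‖ ^ 2 + κ t * (2 * ⟪x t - y t, x₁ - y₁⟫))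
        + ⟪lam t - l t, lam₁ - l₁⟫) t := by
  have hfx : HasDerivAt (fun r => f (x r)) ⟪f' (x t), x₁⟫ t := by
    simpa [Function.comp_def] using (hf (x t)).hasFDerivAt.comp_hasDerivAt t hx
  have hfy : HasDerivAt (fun r => f (y r)) ⟪f' (y t), y₁⟫ t := by
    simpa [Function.comp_def] using (hf (y t)).hasFDerivAt.comp_hasDerivAt t hy
  have hA : HasDerivAt (fun r => A (x r - y r)) (A (x₁ - y₁)) t :=
    A.hasFDerivAt.comp_hasDerivAt t (hx.sub hy)
  have hH := ((hfx.sub hfy).add (hl.inner ℝ hA)).add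
    ((hε.div_const 2).mul (hx.norm_sq.sub hy.norm_sq))
  have hV := ((((hx.sub hy).const_smul a).add (hμ.smul hv)).add (hg.smul hG)).norm_sq.div_const 2
  have hU := (hκ.mul (hx.sub hy).norm_sq).const_mul (a / 2)
  have hL := (hlam.sub hl).norm_sq.div_const 2
  refine ((((hδ.mul hH).add hV).add hU).add hL).congr_deriv ?_
  simp only [Pi.add_apply, Pi.sub_apply, Pi.smul_apply, Pi.mul_apply, Pi.smul_apply']
  ring

/-- Upper bound for the derivative of the energy functional along the primal-dual dynamics. -/
lemma energy_deriv_le [CompleteSpace Y] {x y x₁ y₁ x₂ G G₁ gx gy : X} {lam l lam₁ l₁ : Y} {fx fy : ℝ}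
    {δ δ₁ μ μ₁ κ κ₁ g g₁ B β ε ε₁ a H : ℝ} (ha : 0 ≤ a) (hβ0 : 0 ≤ β)
    (hconv : fx + ⟪gx, y - x⟫ ≤ fy)
    (hH : H = fx - fy + ⟪l, A (x - y)⟫ + ε / 2 * (‖x‖ ^ 2 - ‖y‖ ^ 2))
    (hκ : κ = 1 - μ₁) (hβ : β = B - g₁) (hδ : δ = μ * β + g * κ)
    (hG : G = gx + ContinuousLinearMap.adjoint A lam + ε • x)
    (hy : gy + ContinuousLinearMap.adjoint A l + ε • y = 0) (hl : A y - b - ε • l = 0)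
    (hode : μ • x₂ + (a + 1) • x₁ + g • G₁ + B • G = 0)
    (hlam : lam₁ = (a * β) • (A x - b - ε • lam) + δ • A x₁) :
    δ₁ * H + δ * (⟪gx, x₁⟫ - ⟪gy, y₁⟫ + (⟪l, A (x₁ - y₁)⟫ + ⟪l₁, A (x - y)⟫)
          + (ε₁ / 2 * (‖x‖ ^ 2 - ‖y‖ ^ 2) + ε * (⟪x, x₁⟫ - ⟪y, y₁⟫)))
        + ⟪a • (x - y) + μ • x₁ + g • G, a • (x₁ - y₁) + (μ • x₂ + μ₁ • x₁) + (g • G₁ + g₁ • G)⟫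
        + a / 2 * (κ₁ * ‖x - y‖ ^ 2 + κ * (2 * ⟪x - y, x₁ - y₁⟫))
        + ⟪lam - l, lam₁ - l₁⟫
      ≤ δ₁ * H + δ * (ε₁ / 2 * (‖x‖ ^ 2 - ‖y‖ ^ 2) + ⟪l₁, A (x - y)⟫)
        - a * β * (H + ε / 2 * ‖x - y‖ ^ 2) - a * β * ε * ‖lam - l‖ ^ 2 - μ * κ * ‖x₁‖ ^ 2
        - g * β * ‖G‖ ^ 2 - a * ⟪a • (x - y) + μ • x₁ + g • G, y₁⟫ - a * κ * ⟪x - y, y₁⟫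
        - ⟪lam - l, l₁⟫ + a / 2 * κ₁ * ‖x - y‖ ^ 2 := by
  have hv : a • (x₁ - y₁) + (μ • x₂ + μ₁ • x₁) + (g • G₁ + g₁ • G)
      = -(κ • x₁) - β • G - a • y₁ := by
    rw [← sub_eq_zero, ← hode, hκ, hβ]
    module
  have hgx : gx = G - ContinuousLinearMap.adjoint A lam - ε • x := by rw [hG]; abel
  have hgy : gy = -ContinuousLinearMap.adjoint A l - ε • y := by
    rw [eq_sub_iff_add_eq, eq_neg_iff_add_eq_zero, ← hy]; abel
  have hres : A x - b - ε • lam = A (x - y) - ε • (lam - l) := by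
    rw [← sub_eq_zero, ← hl, map_sub]
    module
  have hw : ⟪lam - l, lam₁ - l₁⟫ = a * β * (⟪lam, A (x - y)⟫ - ⟪l, A (x - y)⟫)
      - a * β * ε * ‖lam - l‖ ^ 2 + δ * (⟪lam, A x₁⟫ - ⟪l, A x₁⟫) - ⟪lam - l, l₁⟫ := by
    rw [hlam, hres, ← real_inner_self_eq_norm_sq]
    simp only [inner_sub_right, inner_add_right, inner_smul_right, inner_sub_left]
    ring
  have h1 : ⟪gx, x₁⟫ = ⟪G, x₁⟫ - ⟪lam, A x₁⟫ - ε * ⟪x, x₁⟫ := by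
    rw [hgx, inner_sub_left, inner_sub_left, ContinuousLinearMap.adjoint_inner_left,
      real_inner_smul_left]
  have h2 : ⟪gy, y₁⟫ = -⟪l, A y₁⟫ - ε * ⟪y, y₁⟫ := by
    rw [hgy, inner_sub_left, inner_neg_left, ContinuousLinearMap.adjoint_inner_left,
      real_inner_smul_left]
  have h3 : ⟪gx, y - x⟫ = -⟪x - y, G⟫ + ⟪lam, A (x - y)⟫ + ε * ⟪x, x - y⟫ := by
    rw [hgx, ← neg_sub x y, inner_neg_right, inner_sub_left, inner_sub_left,
      ContinuousLinearMap.adjoint_inner_left, real_inner_smul_left, real_inner_comm G]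
    ring
  have h4 : ‖y‖ ^ 2 = ‖x‖ ^ 2 - 2 * ⟪x, x - y⟫ + ‖x - y‖ ^ 2 := by
    rw [← norm_sub_sq_real, sub_sub_cancel]
  have hin : H + ε / 2 * ‖x - y‖ ^ 2
      ≤ ⟪x - y, G⟫ - (⟪lam, A (x - y)⟫ - ⟪l, A (x - y)⟫) := by
    rw [hH, h4]
    rw [h3] at hconv
    linarith
  have hin' := mul_le_mul_of_nonneg_left hin (mul_nonneg ha hβ0)
  have hvv : ⟪a • (x - y) + μ • x₁ + g • G, -(κ • x₁) - β • G - a • y₁⟫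
      = -(a * κ) * ⟪x - y, x₁⟫ - a * β * ⟪x - y, G⟫ - μ * κ * ‖x₁‖ ^ 2
        - (μ * β + g * κ) * ⟪G, x₁⟫ - g * β * ‖G‖ ^ 2
        - a * ⟪a • (x - y) + μ • x₁ + g • G, y₁⟫ := by
    rw [← real_inner_self_eq_norm_sq, ← real_inner_self_eq_norm_sq]
    generalize x - y = u
    simp only [inner_sub_right, inner_add_left, inner_neg_right, inner_smul_right,
      real_inner_smul_left]
    rw [real_inner_comm G x₁]
    ring
  rw [hv, hvv, hw, h1, h2, map_sub A x₁ y₁, inner_sub_right l, inner_sub_right (x - y), ← hδ]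
  linarith

end Energy

/-- Absorption of the perturbation terms into the dissipation of the energy functional. -/
lemma dissipation_estimate {U V w z G H δ δ₁ μ κ κ₁ β g B ρ ε η W a c γ k₁ k K C : ℝ}
    (ha : 0 < a) (hγ : 0 < γ) (hk : 0 < k) (hK : 0 < K)
    (hkU : k * (1 + 3 * a ^ 2) ≤ a * c / 8) (hkz : 6 * k * k₁ ≤ 1) (hkG : 6 * k * γ ≤ 1)
    (hK₁ : 3 * k₁ * K ≤ a / 4) (hK₂ : K * (1 + a) ≤ k / 2)
    (hH : 0 ≤ H) (hρ : 0 < ρ) (hρ₁ : ρ ≤ 1) (hB : 0 < B) (hμ : 0 ≤ μ) (hμk : μ ≤ k₁)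
    (hκ : 1 / 2 ≤ κ) (hκ' : κ ≤ 2) (hκ₁ : κ₁ ≤ c / 4 * ρ) (hβ : B / 2 ≤ β) (hε : 0 ≤ ε)
    (hBε : B * ε = c * ρ) (hg : g ^ 2 ≤ 2 * γ * (g * β)) (hδ : δ ≤ 3 * k₁ * B)
    (hδ₁ : δ₁ ≤ a / 4 * B) (hV : V ^ 2 ≤ 3 * (a ^ 2 * U ^ 2 + μ ^ 2 * z ^ 2 + g ^ 2 * G ^ 2))
    (hη : η ^ 2 ≤ C * (ρ ^ 2 * W)) :
    δ₁ * H - a * β * (H + ε / 2 * U ^ 2) - a * β * ε * w ^ 2 - μ * κ * z ^ 2 - g * β * G ^ 2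
        + a / 2 * κ₁ * U ^ 2 + η * (U + V + w)
      ≤ -(K * ρ * (δ * H + V ^ 2 / 2 + a / 2 * (κ * U ^ 2) + w ^ 2 / 2))
        + 3 * C / (2 * k) * (ρ * W) := by
  have absorb : ∀ r : ℝ, η * r ≤ k / 2 * ρ * r ^ 2 + C / (2 * k) * (ρ * W) := by
    intro r
    have h : 2 * k * ρ * (η * r) ≤ 2 * k * ρ * (k / 2 * ρ * r ^ 2 + C / (2 * k) * (ρ * W)) := by
      have e : 2 * k * ρ * (k / 2 * ρ * r ^ 2 + C / (2 * k) * (ρ * W))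
          = (k * ρ * r) ^ 2 + C * (ρ ^ 2 * W) := by field_simp
      rw [e]
      linarith [sq_nonneg (k * ρ * r - η)]
    exact le_of_mul_le_mul_left h (by positivity)
  have hβε : c * ρ / 2 ≤ β * ε := by linarith [mul_le_mul_of_nonneg_right hβ hε]
  have tH : δ₁ * H - a * β * H ≤ -(a / 4) * (B * H) := by
    have h1 := mul_le_mul_of_nonneg_right hδ₁ hH
    have h2 := mul_le_mul_of_nonneg_left (mul_le_mul_of_nonneg_right hβ hH) ha.le
    linarith
  have tU : -(a * β * (ε / 2 * U ^ 2)) + a / 2 * κ₁ * U ^ 2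
      ≤ -(k * ρ * (1 + 3 * a ^ 2)) * U ^ 2 := by
    have h1 := mul_le_mul_of_nonneg_left hβε (by positivity : 0 ≤ a / 2 * U ^ 2)
    have h2 := mul_le_mul_of_nonneg_left hκ₁ (by positivity : 0 ≤ a / 2 * U ^ 2)
    have h3 := mul_le_mul_of_nonneg_left hkU (by positivity : 0 ≤ ρ * U ^ 2)
    linarith
  have tw : -(a * β * ε * w ^ 2) ≤ -(k * ρ) * w ^ 2 := by
    have h1 := mul_le_mul_of_nonneg_left hβε (by positivity : 0 ≤ a * w ^ 2)
    have h2 : k ≤ a * c / 2 := by linarith [mul_pos hk (pow_pos ha 2)]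
    have h3 := mul_le_mul_of_nonneg_left h2 (by positivity : 0 ≤ ρ * w ^ 2)
    linarith
  have tz : -(μ * κ * z ^ 2) ≤ -(3 * k * ρ) * (μ ^ 2 * z ^ 2) := by
    have h1 : μ * (1 / 2) ≤ μ * κ := mul_le_mul_of_nonneg_left hκ hμ
    have h2 : 3 * k * ρ * μ ^ 2 ≤ μ * (1 / 2) := by
      have e1 : ρ * (k * μ) ≤ 1 * (k * k₁) :=
        mul_le_mul hρ₁ (mul_le_mul_of_nonneg_left hμk hk.le) (by positivity) zero_le_one
      have e2 := mul_le_mul_of_nonneg_left e1 hμ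
      have e3 := mul_le_mul_of_nonneg_left hkz hμ
      linarith
    linarith [mul_le_mul_of_nonneg_right (h2.trans h1) (sq_nonneg z)]
  have tG : -(g * β * G ^ 2) ≤ -(3 * k * ρ) * (g ^ 2 * G ^ 2) := by
    have h0 : 0 ≤ g * β :=
      (mul_nonneg_iff_of_pos_left (by positivity)).mp ((sq_nonneg g).trans hg)
    have h1 : 3 * k * ρ * g ^ 2 ≤ g * β := by
      have e1 := mul_le_mul_of_nonneg_right hρ₁ (by positivity : 0 ≤ 3 * k * g ^ 2)
      have e2 := mul_le_mul_of_nonneg_left hg (by positivity : 0 ≤ 3 * k)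
      have e3 := mul_le_mul_of_nonneg_right hkG h0
      linarith
    linarith [mul_le_mul_of_nonneg_right h1 (sq_nonneg G)]
  have tV := mul_le_mul_of_nonneg_left hV (by positivity : 0 ≤ k * ρ)
  have tE₁ : K * ρ * (δ * H) ≤ a / 4 * (B * H) := by
    have h1 : K * ρ * (δ * H) ≤ K * ρ * (3 * k₁ * B * H) :=
      mul_le_mul_of_nonneg_left (mul_le_mul_of_nonneg_right hδ hH) (by positivity)
    have hk₁ : 0 ≤ k₁ := hμ.trans hμk
    have h2 : ρ * (3 * k₁ * K * (B * H)) ≤ 1 * (3 * k₁ * K * (B * H)) :=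
      mul_le_mul_of_nonneg_right hρ₁ (by positivity)
    have h3 := mul_le_mul_of_nonneg_right hK₁ (by positivity : 0 ≤ B * H)
    linarith
  have tE₂ : K * ρ * (V ^ 2 / 2 + a / 2 * (κ * U ^ 2) + w ^ 2 / 2)
      ≤ k / 2 * ρ * (V ^ 2 + U ^ 2 + w ^ 2) := by
    have h1 : a / 2 * (κ * U ^ 2) ≤ a * U ^ 2 := by
      linarith [mul_le_mul_of_nonneg_left hκ' (by positivity : 0 ≤ a * U ^ 2)]
    have h2 : V ^ 2 / 2 + a / 2 * (κ * U ^ 2) + w ^ 2 / 2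
        ≤ (1 + a) * (V ^ 2 + U ^ 2 + w ^ 2) := by
      linarith [sq_nonneg V, sq_nonneg U, sq_nonneg w, mul_nonneg ha.le (sq_nonneg V),
        mul_nonneg ha.le (sq_nonneg w)]
    have h3 := mul_le_mul_of_nonneg_left h2 (by positivity : 0 ≤ K * ρ)
    have h4 := mul_le_mul_of_nonneg_right hK₂ (by positivity : 0 ≤ ρ * (V ^ 2 + U ^ 2 + w ^ 2))
    linarith
  have aU := absorb U
  have aV := absorb V
  have aw := absorb w
  have e : 3 * C / (2 * k) * (ρ * W) = 3 * (C / (2 * k) * (ρ * W)) := by ring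
  rw [e]
  linarith

set_option maxHeartbeats 1000000 in
/-- Bounds for the coefficients of the dynamics and their derivatives. Here `Q`, `S` stand for the
powers `t ^ q`, `t ^ s`. -/
lemma coefficient_bounds_s14 {t Q S m m₁ m₂ q s γ k₁ k₂ μ₁ κ κ₁ β β₁ δ δ₁ : ℝ}
    (ht : 1 ≤ t) (hQ : 1 ≤ Q) (hS : 1 ≤ S) (hm : 0 < m) (hq0 : 0 < q) (hq1 : q < 1) (hs : 0 < s)
    (hγ : 0 < γ) (hk₂ : 0 < k₂) (hmγ : γ ≤ m * (Q * S)) (hmk : m * Q ≤ k₁)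
    (hm₁ : t * |m₁| ≤ k₂ * m) (hm₂ : t ^ 2 * |m₂| ≤ k₂ * m)
    (htγ : 2 * γ ≤ t) (htk : 2 * ((k₂ + 1) * k₁) ≤ t)
    (hμ₁ : μ₁ = m₁ * Q + m * (q * Q / t)) (hκ : κ = 1 - μ₁)
    (hκ₁ : κ₁ = -(m₂ * Q + 2 * (m₁ * (q * Q / t)) + m * (q * (q - 1) * Q / t ^ 2)))
    (hβ : β = Q * S - γ * (q * Q / t))
    (hβ₁ : β₁ = (q + s) * (Q * S) / t - γ * (q * (q - 1) * Q / t ^ 2))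
    (hδ : δ = m * Q * β + γ * Q * κ)
    (hδ₁ : δ₁ = μ₁ * β + m * Q * β₁ + (γ * (q * Q / t) * κ + γ * Q * κ₁)) :
    1 / 2 ≤ κ ∧ κ ≤ 2 ∧ |κ₁| ≤ (3 * k₂ + 1) * k₁ / t ^ 2 ∧ Q * S / 2 ≤ β ∧ γ / 2 ≤ δ ∧
      δ ≤ 3 * (m * Q * (Q * S)) ∧
      |δ₁| ≤ ((k₂ + 1) * k₁ + k₁ * (1 + s + γ) + 2 * γ + γ * ((3 * k₂ + 1) * k₁)) * (Q * S) / t := by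
  have ht0 : 0 < t := by linarith
  have hQ0 : 0 < Q := by linarith
  have hS0 : 0 < S := by linarith
  have hk₁ : 0 < k₁ := lt_of_lt_of_le (by positivity) hmk
  have hQS : Q ≤ Q * S := le_mul_of_one_le_right hQ0.le hS
  have habs₁ : |m₁| ≤ k₂ * m / t := by rw [le_div_iff₀ ht0]; linarith
  have habs₂ : |m₂| ≤ k₂ * m / t ^ 2 := by rw [le_div_iff₀ (by positivity)]; linarith
  have hq1' : |q * (q - 1)| ≤ 1 := by rw [abs_le]; constructor <;> nlinarith
  have bμ₁ : |μ₁| ≤ (k₂ + 1) * k₁ / t := by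
    have h1 : |m₁ * Q| ≤ k₂ * m / t * Q := by
      rw [abs_mul, abs_of_pos hQ0]; exact mul_le_mul_of_nonneg_right habs₁ hQ0.le
    have h2 : |m * (q * Q / t)| ≤ m * Q / t := by
      rw [abs_of_pos (by positivity), ← mul_div_assoc]
      apply div_le_div_of_nonneg_right _ ht0.le
      nlinarith [mul_pos hm hQ0]
    calc |μ₁| ≤ k₂ * m / t * Q + m * Q / t := by
          rw [hμ₁]; exact (abs_add_le _ _).trans (add_le_add h1 h2)
      _ = (k₂ + 1) * (m * Q) / t := by ring
      _ ≤ (k₂ + 1) * k₁ / t := by gcongr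
  have hμ₁half : |μ₁| ≤ 1 / 2 := by
    refine bμ₁.trans ?_
    rw [div_le_iff₀ ht0]; linarith
  obtain ⟨hμl, hμu⟩ := abs_le.mp hμ₁half
  have bκ : 1 / 2 ≤ κ := by linarith
  have bκ' : κ ≤ 2 := by linarith
  have bκ₁ : |κ₁| ≤ (3 * k₂ + 1) * k₁ / t ^ 2 := by
    have h1 : |m₂ * Q| ≤ k₂ * m / t ^ 2 * Q := by
      rw [abs_mul, abs_of_pos hQ0]; exact mul_le_mul_of_nonneg_right habs₂ hQ0.le
    have h2 : |2 * (m₁ * (q * Q / t))| ≤ 2 * (k₂ * m / t * (Q / t)) := by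
      rw [abs_mul, abs_mul, abs_two, abs_of_pos (by positivity : 0 < q * Q / t)]
      gcongr
      nlinarith
    have h3 : |m * (q * (q - 1) * Q / t ^ 2)| ≤ m * (1 * Q / t ^ 2) := by
      rw [abs_mul, abs_of_pos hm, abs_div, abs_mul, abs_of_pos hQ0, abs_of_pos (pow_pos ht0 2)]
      gcongr
    calc |κ₁| ≤ k₂ * m / t ^ 2 * Q + 2 * (k₂ * m / t * (Q / t)) + m * (1 * Q / t ^ 2) := by
          rw [hκ₁, abs_neg]
          exact (abs_add_le _ _).trans (add_le_add ((abs_add_le _ _).trans (add_le_add h1 h2)) h3)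
      _ = (3 * k₂ + 1) * (m * Q) / t ^ 2 := by ring
      _ ≤ (3 * k₂ + 1) * k₁ / t ^ 2 := by gcongr
  have hγt : γ * (q * Q / t) ≤ Q / 2 := by
    rw [← mul_div_assoc, div_le_iff₀ ht0]
    have : γ * (q * Q) ≤ γ * (1 * Q) := by gcongr
    nlinarith
  have bβ : Q * S / 2 ≤ β := by linarith
  have bβ' : β ≤ Q * S := by
    have : 0 < γ * (q * Q / t) := by positivity
    linarith
  have hβ0 : 0 < β := lt_of_lt_of_le (by positivity) bβ
  have bβ₁ : |β₁| ≤ (1 + s + γ) * (Q * S) / t := by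
    have h1 : |(q + s) * (Q * S) / t| ≤ (1 + s) * (Q * S) / t := by
      rw [abs_of_pos (by positivity)]; gcongr
    have h2 : |γ * (q * (q - 1) * Q / t ^ 2)| ≤ γ * (1 * (Q * S) / t) := by
      rw [abs_mul, abs_of_pos hγ, abs_div, abs_mul, abs_of_pos hQ0, abs_of_pos (pow_pos ht0 2)]
      gcongr
      nlinarith
    calc |β₁| ≤ (1 + s) * (Q * S) / t + γ * (1 * (Q * S) / t) := by
          rw [hβ₁]; exact (abs_sub _ _).trans (add_le_add h1 h2)
      _ = (1 + s + γ) * (Q * S) / t := by ring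
  refine ⟨bκ, bκ', bκ₁, bβ, ?_, ?_, ?_⟩
  · have h1 : 0 < m * Q * β := by positivity
    have h2 : γ * 1 * (1 / 2) ≤ γ * Q * κ := by gcongr
    linarith
  · have h1 : m * Q * β ≤ m * Q * (Q * S) := by gcongr
    have h2 : γ * Q * κ ≤ m * (Q * S) * Q * 2 := by gcongr
    linarith
  · have h1 : |μ₁ * β| ≤ (k₂ + 1) * k₁ / t * (Q * S) := by
      rw [abs_mul, abs_of_pos hβ0]; gcongr
    have h2 : |m * Q * β₁| ≤ k₁ * ((1 + s + γ) * (Q * S) / t) := by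
      rw [abs_mul, abs_of_pos (by positivity : 0 < m * Q)]; gcongr
    have h3 : |γ * (q * Q / t) * κ| ≤ γ * (1 * (Q * S) / t) * 2 := by
      rw [abs_of_pos (by positivity)]; gcongr
    have h4 : |γ * Q * κ₁| ≤ γ * (Q * S) * ((3 * k₂ + 1) * k₁ / t) := by
      rw [abs_mul, abs_of_pos (by positivity : 0 < γ * Q)]
      have : (3 * k₂ + 1) * k₁ / t ^ 2 ≤ (3 * k₂ + 1) * k₁ / t :=
        div_le_div_of_nonneg_left (by positivity) ht0 (by nlinarith)
      have h := bκ₁.trans this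
      gcongr
    calc |δ₁| ≤ (k₂ + 1) * k₁ / t * (Q * S) + k₁ * ((1 + s + γ) * (Q * S) / t)
          + (γ * (1 * (Q * S) / t) * 2 + γ * (Q * S) * ((3 * k₂ + 1) * k₁ / t)) := by
          rw [hδ₁]
          exact (abs_add_le _ _).trans (add_le_add ((abs_add_le _ _).trans (add_le_add h1 h2))
            ((abs_add_le _ _).trans (add_le_add h3 h4)))
      _ = _ := by ring

/-- Bound for the terms of the energy derivative caused by the motion of the saddle points. -/
lemma perturbation_le_s14 {X Y : Type*} [NormedAddCommGroup X] [InnerProductSpace ℝ X]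
    [NormedAddCommGroup Y] [InnerProductSpace ℝ Y] (A : X →L[ℝ] Y)
    {x y y₁ v : X} {w l₁ : Y} {δ κ ε₁ a c R d : ℝ} (ha : 0 ≤ a) (hκ : 0 ≤ κ) (hκ' : κ ≤ 2)
    (hδ : 0 ≤ δ) (hR : 0 ≤ R) (hd : 0 ≤ d) (hε₁ : ε₁ ≤ 0) (hε₁' : -ε₁ ≤ c * d)
    (hy : ‖y‖ ≤ R) (hy₁ : ‖y₁‖ ≤ R * d) (hl₁ : ‖l₁‖ ≤ R * d) :
    δ * (ε₁ / 2 * (‖x‖ ^ 2 - ‖y‖ ^ 2) + ⟪l₁, A (x - y)⟫) - a * ⟪v, y₁⟫ - a * κ * ⟪x - y, y₁⟫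
        - ⟪w, l₁⟫
      ≤ (δ * (R * (c + ‖A‖)) + (3 * a + 1) * R) * d * (‖x - y‖ + ‖v‖ + ‖w‖) := by
  have hx : ‖x‖ ^ 2 = ‖y‖ ^ 2 + 2 * ⟪y, x - y⟫ + ‖x - y‖ ^ 2 := by
    rw [← norm_add_sq_real, add_sub_cancel]
  have hcd : 0 ≤ c * d := by linarith
  have i1 := (abs_le.mp (abs_real_inner_le_norm y (x - y))).1
  have i2 := real_inner_le_norm l₁ (A (x - y))
  have i3 := (abs_le.mp (abs_real_inner_le_norm v y₁)).1
  have i4 := (abs_le.mp (abs_real_inner_le_norm (x - y) y₁)).1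
  have i5 := (abs_le.mp (abs_real_inner_le_norm w l₁)).1
  have i6 := A.le_opNorm (x - y)
  set U := ‖x - y‖
  have hU : 0 ≤ U := norm_nonneg _
  have j1 : ε₁ / 2 * (‖x‖ ^ 2 - ‖y‖ ^ 2) ≤ c * d * (R * U) := by
    have e1 : ‖y‖ * U ≤ R * U := by gcongr
    have e2 : -ε₁ * -⟪y, x - y⟫ ≤ -ε₁ * (R * U) :=
      mul_le_mul_of_nonneg_left (by linarith) (by linarith)
    have e3 : -ε₁ * (R * U) ≤ c * d * (R * U) :=
      mul_le_mul_of_nonneg_right hε₁' (by positivity)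
    have e4 : 0 ≤ -ε₁ * U ^ 2 := mul_nonneg (by linarith) (sq_nonneg _)
    rw [hx]
    linarith
  have j2 : ⟪l₁, A (x - y)⟫ ≤ R * d * (‖A‖ * U) := i2.trans (by gcongr)
  have j3 : -⟪v, y₁⟫ ≤ ‖v‖ * (R * d) :=
    (by linarith : -⟪v, y₁⟫ ≤ ‖v‖ * ‖y₁‖).trans (by gcongr)
  have j4 : -⟪x - y, y₁⟫ ≤ U * (R * d) :=
    (by linarith : -⟪x - y, y₁⟫ ≤ U * ‖y₁‖).trans (by gcongr)
  have j5 : -⟪w, l₁⟫ ≤ ‖w‖ * (R * d) :=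
    (by linarith : -⟪w, l₁⟫ ≤ ‖w‖ * ‖l₁‖).trans (by gcongr)
  have k1 := mul_le_mul_of_nonneg_left (add_le_add j1 j2) hδ
  have k3 := mul_le_mul_of_nonneg_left j3 ha
  have k4 : a * κ * -⟪x - y, y₁⟫ ≤ a * 2 * (U * (R * d)) :=
    (mul_le_mul_of_nonneg_left j4 (by positivity)).trans (by gcongr)
  set s := R * d with hs
  have hs0 : 0 ≤ s := by positivity
  have hr : 0 ≤ δ * (R * (c + ‖A‖)) * d * (‖v‖ + ‖w‖) := by
    have : 0 ≤ δ * (R * (c * d + ‖A‖ * d)) * (‖v‖ + ‖w‖) := by positivity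
    linarith
  have hr' : 0 ≤ s * (U + a * U + 2 * a * ‖v‖ + ‖v‖ + 3 * a * ‖w‖) := by positivity
  have e : (δ * (R * (c + ‖A‖)) + (3 * a + 1) * R) * d * (U + ‖v‖ + ‖w‖)
      = δ * (c * d * (R * U) + s * (‖A‖ * U)) + δ * (R * (c + ‖A‖)) * d * (‖v‖ + ‖w‖)
        + (3 * a + 1) * s * (U + ‖v‖ + ‖w‖) := by rw [hs]; ring
  rw [e]
  linarith

lemma norm_sq_add_add_le {V : Type*} [NormedAddCommGroup V] (u v w : V) :
    ‖u + v + w‖ ^ 2 ≤ 3 * (‖u‖ ^ 2 + ‖v‖ ^ 2 + ‖w‖ ^ 2) := by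
  have h : ‖u + v + w‖ ≤ ‖u‖ + ‖v‖ + ‖w‖ := norm_add₃_le
  have h2 : ‖u + v + w‖ ^ 2 ≤ (‖u‖ + ‖v‖ + ‖w‖) ^ 2 := by gcongr
  nlinarith [sq_nonneg (‖u‖ - ‖v‖), sq_nonneg (‖u‖ - ‖w‖), sq_nonneg (‖v‖ - ‖w‖)]

lemma hasDerivAt_rpow_mul_div {t : ℝ} (ht : 0 < t) (q : ℝ) :
    HasDerivAt (fun r : ℝ => r ^ q) (q * t ^ q / t) t := by
  refine (Real.hasDerivAt_rpow_const (Or.inl ht.ne')).congr_deriv ?_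
  rw [Real.rpow_sub_one ht.ne', mul_div_assoc]

/-- Derivatives of the coefficients of the dynamics. -/
lemma coefficient_hasDerivAt {m m' : ℝ → ℝ} {m₂ q s γ t : ℝ} (ht : 0 < t)
    (hm : HasDerivAt m (m' t) t) (hm' : HasDerivAt m' m₂ t) {μ κ β δ : ℝ → ℝ} {μ₁ κ₁ β₁ δ₁ : ℝ}
    (hμ : ∀ r, μ r = m r * r ^ q)
    (hκ : ∀ r, κ r = 1 - (m' r * r ^ q + m r * (q * r ^ q / r)))
    (hβ : ∀ r, β r = r ^ q * r ^ s - γ * (q * r ^ q / r))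
    (hδ : ∀ r, δ r = μ r * β r + γ * r ^ q * κ r)
    (hμ₁ : μ₁ = m' t * t ^ q + m t * (q * t ^ q / t))
    (hκ₁ : κ₁ = -(m₂ * t ^ q + 2 * (m' t * (q * t ^ q / t))
      + m t * (q * (q - 1) * t ^ q / t ^ 2)))
    (hβ₁ : β₁ = (q + s) * (t ^ q * t ^ s) / t - γ * (q * (q - 1) * t ^ q / t ^ 2))
    (hδ₁ : δ₁ = μ₁ * β t + m t * t ^ q * β₁ + (γ * (q * t ^ q / t) * κ t + γ * t ^ q * κ₁)) :
    HasDerivAt μ μ₁ t ∧ HasDerivAt κ κ₁ t ∧ HasDerivAt δ δ₁ t := by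
  have hQ := hasDerivAt_rpow_mul_div ht q
  have hS := hasDerivAt_rpow_mul_div ht s
  have hQd : HasDerivAt (fun r : ℝ => q * r ^ q / r) (q * (q - 1) * t ^ q / t ^ 2) t := by
    refine ((hQ.const_mul q).div (hasDerivAt_id t) ht.ne').congr_deriv ?_
    simp only [id]
    field_simp
  have dμ : HasDerivAt μ μ₁ t := by
    rw [funext hμ, hμ₁]
    exact hm.mul hQ
  have dκ : HasDerivAt κ κ₁ t := by
    rw [funext hκ, hκ₁]
    refine (((hm'.mul hQ).add (hm.mul hQd)).const_sub 1).congr_deriv ?_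
    ring
  have dβ : HasDerivAt β β₁ t := by
    rw [funext hβ, hβ₁]
    refine ((hQ.mul hS).sub (hQd.const_mul γ)).congr_deriv ?_
    ring
  refine ⟨dμ, dκ, ?_⟩
  have h := (dμ.mul dβ).add ((hQ.const_mul γ).mul dκ)
  rw [funext hδ, hδ₁, ← hμ t]
  exact h

/-- Squared size of the perturbation in terms of the mass coefficient. -/
lemma sq_perturbation_le {m Q S γ k₁ δ r₁ r₂ : ℝ} (hQ : 1 ≤ Q) (hS : 1 ≤ S) (hm : 0 < m)
    (hγ : 0 < γ) (hmγ : γ ≤ m * (Q * S)) (hmk : m * Q ≤ k₁) (hδ0 : 0 ≤ δ)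
    (hδ : δ ≤ 3 * (m * Q * (Q * S))) :
    (δ * r₁ + r₂) ^ 2 ≤ 2 * (9 * k₁ * r₁ ^ 2 + r₂ ^ 2 / γ) * (m * Q ^ 4 * S ^ 2) := by
  have hQ0 : 0 < Q := by linarith
  have hS0 : 0 < S := by linarith
  have hk : m ≤ k₁ := (le_mul_of_one_le_right hm.le hQ).trans hmk
  have h1 : δ ^ 2 ≤ 9 * k₁ * (m * Q ^ 4 * S ^ 2) := by
    calc δ ^ 2 ≤ (3 * (m * Q * (Q * S))) ^ 2 := by gcongr
      _ = 9 * m * (m * Q ^ 4 * S ^ 2) := by ring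
      _ ≤ 9 * k₁ * (m * Q ^ 4 * S ^ 2) := by gcongr
  have h2 : γ ≤ m * Q ^ 4 * S ^ 2 := by
    have h3 : (1 : ℝ) ≤ Q ^ 3 * S := one_le_mul_of_one_le_of_one_le (one_le_pow₀ hQ) hS
    calc γ ≤ m * (Q * S) := hmγ
      _ ≤ m * (Q * S) * (Q ^ 3 * S) := le_mul_of_one_le_right (by positivity) h3
      _ = m * Q ^ 4 * S ^ 2 := by ring
  have h4 : r₂ ^ 2 ≤ r₂ ^ 2 / γ * (m * Q ^ 4 * S ^ 2) := by
    rw [div_mul_eq_mul_div, le_div_iff₀ hγ]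
    gcongr
  have h5 := mul_le_mul_of_nonneg_right h1 (sq_nonneg r₁)
  linarith [sq_nonneg (δ * r₁ - r₂)]

set_option maxHeartbeats 4000000 in
/-- Energy decay along the primal-dual dynamics: the energy is dominated by
`m t * (t ^ q) ^ 2 * (t ^ p) ^ 2 / t ^ 2`. -/
lemma energy_decay {X Y : Type*} [NormedAddCommGroup X] [InnerProductSpace ℝ X] [CompleteSpace X]
    [NormedAddCommGroup Y] [InnerProductSpace ℝ Y] [CompleteSpace Y]
    {f : X → ℝ} {f' : X → X} (hf : ∀ u, HasGradientAt f (f' u) u)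
    (hconv : ConvexOn ℝ Set.univ f) {A : X →L[ℝ] Y} {b : Y}
    {c p q s γ a k₁ k₂ t₀ R : ℝ} (hc : 0 < c) (hp0 : 0 < p) (hp1 : p < 1) (hq0 : 0 < q)
    (hq1 : q < 1) (hs : 0 < s) (hγ : 0 < γ) (ha : 0 < a) (hk₁ : 0 < k₁) (hk₂ : 0 < k₂)
    (ht₀ : 0 < t₀) (hR : 0 ≤ R) (hqsp : q + s ≤ p)
    {m m' m'' : ℝ → ℝ} (hmpos : ∀ t ≥ t₀, 0 < m t)
    (hmd : ∀ t ≥ t₀, HasDerivAt m (m' t) t) (hmd2 : ∀ t ≥ t₀, HasDerivAt m' (m'' t) t)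
    (hmγ : ∀ t ≥ t₀, γ ≤ m t * (t ^ q * t ^ s)) (hmk : ∀ t ≥ t₀, m t * t ^ q ≤ k₁)
    (hm1 : ∀ t ≥ t₀, t * |m' t| ≤ k₂ * m t) (hm2 : ∀ t ≥ t₀, t ^ 2 * |m'' t| ≤ k₂ * m t)
    {μ κ β δ : ℝ → ℝ} (hμ : ∀ r, μ r = m r * r ^ q)
    (hκ : ∀ r, κ r = 1 - (m' r * r ^ q + m r * (q * r ^ q / r)))
    (hβ : ∀ r, β r = r ^ q * r ^ s - γ * (q * r ^ q / r))
    (hδ : ∀ r, δ r = μ r * β r + γ * r ^ q * κ r)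
    {x x' x'' G G' : ℝ → X} {lam lam' : ℝ → Y}
    (hx : ∀ t ≥ t₀, HasDerivAt x (x' t) t) (hx' : ∀ t ≥ t₀, HasDerivAt x' (x'' t) t)
    (hlam : ∀ t ≥ t₀, HasDerivAt lam (lam' t) t)
    (hGd : ∀ t ≥ t₀, HasDerivAt G (G' t) t)
    (hG : ∀ t ≥ t₀, G t = f' (x t) + ContinuousLinearMap.adjoint A (lam t) + (c / t ^ p) • x t)
    (hode1 : ∀ t ≥ t₀,
      μ t • x'' t + (a + 1) • x' t + (γ * t ^ q) • G' t + (t ^ q * t ^ s) • G t = 0)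
    (hode2 : ∀ t ≥ t₀,
      lam' t = (a * β t) • (A (x t) - b - (c / t ^ p) • lam t) + δ t • A (x' t))
    {y y' : ℝ → X} {l l' : ℝ → Y}
    (hy : ∀ t ≥ t₀, HasDerivAt y (y' t) t) (hl : ∀ t ≥ t₀, HasDerivAt l (l' t) t)
    (hsy : ∀ t ≥ t₀, f' (y t) + ContinuousLinearMap.adjoint A (l t) + (c / t ^ p) • y t = 0)
    (hsl : ∀ t ≥ t₀, A (y t) - b - (c / t ^ p) • l t = 0)
    (hyR : ∀ t ≥ t₀, ‖y t‖ ^ 2 + ‖l t‖ ^ 2 ≤ R ^ 2) :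
    ∃ M, 0 < M ∧ ∀ᶠ t in atTop,
      ‖x t - y t‖ ^ 2 + ‖lam t - l t‖ ^ 2 ≤ M * (m t * (t ^ q) ^ 2 * (t ^ p) ^ 2 / t ^ 2) ∧
      f (x t) - f (y t) + ⟪l t, A (x t - y t)⟫ + c / t ^ p / 2 * (‖x t‖ ^ 2 - ‖y t‖ ^ 2)
        ≤ M * (m t * (t ^ q) ^ 2 * (t ^ p) ^ 2 / t ^ 2) := by
  obtain ⟨k, hk, hkU, hkz, hkG⟩ : ∃ k, 0 < k ∧ k * (1 + 3 * a ^ 2) ≤ a * c / 8 ∧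
      6 * k * k₁ ≤ 1 ∧ 6 * k * γ ≤ 1 := by
    refine ⟨min (a * c / 8 / (1 + 3 * a ^ 2)) (min (1 / (6 * k₁)) (1 / (6 * γ))), by positivity,
      ?_, ?_, ?_⟩
    · rw [← le_div_iff₀ (by positivity)]
      exact min_le_left _ _
    · have := (le_div_iff₀ (by positivity : 0 < 6 * k₁)).mp
        ((min_le_right (a * c / 8 / (1 + 3 * a ^ 2)) _).trans
          (min_le_left (1 / (6 * k₁)) (1 / (6 * γ))))
      linarith
    · have := (le_div_iff₀ (by positivity : 0 < 6 * γ)).mp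
        ((min_le_right (a * c / 8 / (1 + 3 * a ^ 2)) _).trans
          (min_le_right (1 / (6 * k₁)) (1 / (6 * γ))))
      linarith
  obtain ⟨K, hK, hK₁, hK₂⟩ : ∃ K, 0 < K ∧ 3 * k₁ * K ≤ a / 4 ∧ K * (1 + a) ≤ k / 2 := by
    refine ⟨min (a / 4 / (3 * k₁)) (k / 2 / (1 + a)), by positivity, ?_, ?_⟩
    · have := (le_div_iff₀ (by positivity : 0 < 3 * k₁)).mp
        (min_le_left (a / 4 / (3 * k₁)) (k / 2 / (1 + a)))
      linarith
    · rw [← le_div_iff₀ (by positivity)]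
      exact min_le_right _ _
  set C₅ := (k₂ + 1) * k₁ + k₁ * (1 + s + γ) + 2 * γ + γ * ((3 * k₂ + 1) * k₁) with hC₅
  set r₁ := R * (c + ‖A‖) with hr₁
  set r₂ := (3 * a + 1) * R with hr₂
  set C := 2 * (9 * k₁ * r₁ ^ 2 + r₂ ^ 2 / γ) with hCdef
  have hC : 0 ≤ C := by positivity
  obtain ⟨T, hT⟩ : ∃ T, ∀ t ≥ T, t₀ < t ∧ 1 ≤ t ∧ 2 * γ ≤ t ∧ 2 * ((k₂ + 1) * k₁) ≤ t ∧
      4 * C₅ / a ≤ t ∧ 4 * ((3 * k₂ + 1) * k₁) / c ≤ t ∧ 2 * (k₂ + 2) / K ≤ t ^ q := by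
    refine eventually_atTop.mp ?_
    filter_upwards [eventually_gt_atTop t₀, eventually_ge_atTop 1, eventually_ge_atTop (2 * γ),
      eventually_ge_atTop (2 * ((k₂ + 1) * k₁)), eventually_ge_atTop (4 * C₅ / a),
      eventually_ge_atTop (4 * ((3 * k₂ + 1) * k₁) / c),
      (tendsto_rpow_atTop hq0).eventually_ge_atTop (2 * (k₂ + 2) / K)] with t h1 h2 h3 h4 h5 h6 h7
    exact ⟨h1, h2, h3, h4, h5, h6, h7⟩
  set H : ℝ → ℝ := fun t => f (x t) - f (y t) + ⟪l t, A (x t - y t)⟫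
    + c / t ^ p / 2 * (‖x t‖ ^ 2 - ‖y t‖ ^ 2) with hHdef
  set W : ℝ → ℝ := fun t => m t * (t ^ q) ^ 2 * (t ^ p) ^ 2 / t ^ 2 with hWdef
  set ρ : ℝ → ℝ := fun t => t ^ q * t ^ s / t ^ p with hρdef
  set E : ℝ → ℝ := fun t => δ t * H t
    + ‖a • (x t - y t) + μ t • x' t + (γ * t ^ q) • G t‖ ^ 2 / 2
    + a / 2 * (κ t * ‖x t - y t‖ ^ 2) + ‖lam t - l t‖ ^ 2 / 2 with hEdef
  have hH0 : ∀ t ≥ T, 0 ≤ H t := by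
    intro t ht
    have htp : 0 < c / t ^ p := div_pos hc (Real.rpow_pos_of_pos (ht₀.trans (hT t ht).1) p)
    have h := hconv.add_inner_gradient_le (hf (y t)) (x t)
    have hgy : f' (y t) = -ContinuousLinearMap.adjoint A (l t) - (c / t ^ p) • y t := by
      rw [eq_sub_iff_add_eq, eq_neg_iff_add_eq_zero, ← hsy t (hT t ht).1.le]; abel
    rw [hgy, inner_sub_left, inner_neg_left, ContinuousLinearMap.adjoint_inner_left,
      real_inner_smul_left] at h
    have e : ‖x t‖ ^ 2 = ‖y t‖ ^ 2 + 2 * ⟪y t, x t - y t⟫ + ‖x t - y t‖ ^ 2 := by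
      rw [← norm_add_sq_real, add_sub_cancel]
    have : 0 ≤ c / t ^ p * ‖x t - y t‖ ^ 2 := by positivity
    simp only [hHdef]
    rw [e]
    linarith
  have hcoef : ∀ t ≥ T, 1 / 2 ≤ κ t ∧ κ t ≤ 2 ∧ γ / 2 ≤ δ t := by
    intro t ht
    obtain ⟨h0, h1, h2, h3, -, -, -⟩ := hT t ht
    have ht' := h0.le
    obtain ⟨g1, g2, -, -, g5, -, -⟩ := coefficient_bounds_s14 (t := t) (Q := t ^ q) (S := t ^ s) h1
      (Real.one_le_rpow h1 hq0.le) (Real.one_le_rpow h1 hs.le) (hmpos t ht') hq0 hq1 hs hγ hk₂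
      (hmγ t ht') (hmk t ht') (hm1 t ht') (hm2 t ht') h2 h3 rfl (hκ t) rfl (hβ t) rfl
      (δ := δ t) (by rw [hδ t, hμ t]) rfl
    exact ⟨g1, g2, g5⟩
  have hderiv : ∀ t ≥ T, ∃ E₁, HasDerivAt E E₁ t ∧
      E₁ ≤ -(K * ρ t * E t) + 3 * C / (2 * k) * (ρ t * W t) := by
    intro t ht
    obtain ⟨h0, h1, h2, h3, h4, h5, h6⟩ := hT t ht
    have ht' := h0.le
    have htpos : 0 < t := by linarith
    have hQ : 1 ≤ t ^ q := Real.one_le_rpow h1 hq0.le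
    have hS : 1 ≤ t ^ s := Real.one_le_rpow h1 hs.le
    have hP : 1 ≤ t ^ p := Real.one_le_rpow h1 hp0.le
    have hPt : t ^ p ≤ t := by simpa using Real.rpow_le_rpow_of_exponent_le h1 hp1.le
    have hQSP : t ^ q * t ^ s ≤ t ^ p := by
      rw [← Real.rpow_add htpos]; exact Real.rpow_le_rpow_of_exponent_le h1 hqsp
    obtain ⟨dμ, dκ, dδ⟩ := coefficient_hasDerivAt htpos (hmd t ht') (hmd2 t ht') hμ hκ hβ hδ
      rfl rfl rfl rfl
    obtain ⟨g1, g2, g3, g4, g5, g6, g7⟩ := coefficient_bounds_s14 (t := t) (Q := t ^ q) (S := t ^ s) h1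
      hQ hS (hmpos t ht') hq0 hq1 hs hγ hk₂
      (hmγ t ht') (hmk t ht') (hm1 t ht') (hm2 t ht') h2 h3 rfl (hκ t) rfl (hβ t) rfl
      (δ := δ t) (by rw [hδ t, hμ t]) rfl
    have dε : HasDerivAt (fun r : ℝ => c / r ^ p) (-(c * p / (t ^ p * t))) t := by
      refine ((hasDerivAt_const t c).div (hasDerivAt_rpow_mul_div htpos p)
        (by positivity)).congr_deriv ?_
      field_simp
      ring
    have hsmall : |(-(c * p / (t ^ p * t)))| ≤ c * t⁻¹ := by
      rw [abs_neg, abs_of_pos (by positivity), ← div_eq_mul_inv,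
        div_le_div_iff₀ (by positivity) htpos]
      have : p ≤ t ^ p := hp1.le.trans hP
      nlinarith [mul_le_mul_of_nonneg_left this (by positivity : 0 ≤ c * t)]
    have hlip : ∀ᶠ r in 𝓝 t, ‖y r - y t‖ ≤ R / (c / t ^ p) * |c / r ^ p - c / t ^ p| ∧
        ‖l r - l t‖ ≤ R / (c / t ^ p) * |c / r ^ p - c / t ^ p| := by
      filter_upwards [lt_mem_nhds h0] with r hr
      exact regularized_saddle_lipschitz hf hconv (by positivity) hR (hsy t ht') (hsl t ht')
        (hsy r hr.le) (hsl r hr.le) (hyR r hr.le)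
    have hrate : R / (c / t ^ p) * |(-(c * p / (t ^ p * t)))| ≤ R * t⁻¹ := by
      rw [abs_neg, abs_of_pos (by positivity)]
      have e : R / (c / t ^ p) * (c * p / (t ^ p * t)) = R * (p * t⁻¹) := by field_simp
      rw [e]
      have : p * t⁻¹ ≤ 1 * t⁻¹ := by gcongr
      rw [one_mul] at this
      gcongr
    have hy₁ : ‖y' t‖ ≤ R * t⁻¹ :=
      ((hy t ht').norm_le_mul_abs_of_eventually dε (hlip.mono fun _ h => h.1)).trans hrate
    have hl₁ : ‖l' t‖ ≤ R * t⁻¹ :=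
      ((hl t ht').norm_le_mul_abs_of_eventually dε (hlip.mono fun _ h => h.2)).trans hrate
    have hyn : ‖y t‖ ≤ R := abs_le_of_sq_le_sq' (by
      linarith [hyR t ht', sq_nonneg ‖l t‖] : ‖y t‖ ^ 2 ≤ R ^ 2) hR |>.2
    refine ⟨_, energy_hasDerivAt (a := a) hf (hx t ht') (hy t ht') (hx' t ht') (hGd t ht')
      (hlam t ht') (hl t ht') dδ dμ dκ ((hasDerivAt_rpow_mul_div htpos q).const_mul γ) dε, ?_⟩
    have hδ0 : 0 ≤ δ t := by linarith
    have hQpos : 0 < t ^ q := by linarith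
    have hSpos : 0 < t ^ s := by linarith
    have hPpos : 0 < t ^ p := by linarith
    have hβ0 : 0 ≤ β t := le_trans (by positivity) g4
    refine (energy_deriv_le (b := b) (B := t ^ q * t ^ s) (β := β t) (H := H t) ha.le hβ0
      (hconv.add_inner_gradient_le (hf (x t)) (y t)) rfl (hκ t) (hβ t) (hδ t) (hG t ht')
      (hsy t ht') (hsl t ht') (hode1 t ht') (hode2 t ht')).trans ?_
    have hpert := perturbation_le_s14 A (x := x t) (y := y t) (y₁ := y' t)
      (v := a • (x t - y t) + μ t • x' t + (γ * t ^ q) • G t) (w := lam t - l t) (l₁ := l' t)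
      (δ := δ t) (κ := κ t) (ε₁ := -(c * p / (t ^ p * t))) (a := a) (c := c) (R := R) (d := t⁻¹)
      ha.le (by linarith) g2 hδ0 hR (by positivity) (neg_nonpos.mpr (by positivity))
      ((neg_le_abs _).trans hsmall) hyn hy₁ hl₁
    have hρ1 : ρ t ≤ 1 := div_le_one_of_le₀ hQSP hPpos.le
    have hρt : 1 / t ≤ ρ t := by
      simp only [hρdef]
      exact div_le_div₀ (by positivity) (one_le_mul_of_one_le_of_one_le hQ hS) hPpos hPt
    have hdiss := dissipation_estimate (U := ‖x t - y t‖)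
      (V := ‖a • (x t - y t) + μ t • x' t + (γ * t ^ q) • G t‖) (w := ‖lam t - l t‖)
      (z := ‖x' t‖) (G := ‖G t‖) (H := H t) (δ := δ t) (μ := μ t) (κ := κ t) (β := β t)
      (g := γ * t ^ q) (B := t ^ q * t ^ s) (ρ := ρ t) (ε := c / t ^ p)
      (η := (δ t * r₁ + r₂) * t⁻¹) (W := W t) (C := C) ha hγ hk hK hkU hkz hkG hK₁ hK₂
      (hH0 t ht) (by positivity) hρ1 (by positivity)
      (by rw [hμ t]; have := hmpos t ht'; positivity) (by rw [hμ t]; exact hmk t ht') g1 g2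
      (κ₁ := _) ((le_abs_self _).trans (g3.trans ?_)) g4 (by positivity)
      (by simp only [hρdef]; ring) ?_ ?_ (δ₁ := _) ((le_abs_self _).trans (g7.trans ?_)) ?_ ?_
    · have e : (δ t * (R * (c + ‖A‖)) + (3 * a + 1) * R) * t⁻¹ = (δ t * r₁ + r₂) * t⁻¹ := by
        rw [hr₁, hr₂]
      rw [e] at hpert
      simp only [hEdef]
      linarith
    · rw [div_le_iff₀ hc] at h5
      calc (3 * k₂ + 1) * k₁ / t ^ 2 = (3 * k₂ + 1) * k₁ / t * (1 / t) := by field_simp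
        _ ≤ c / 4 * ρ t := by
          refine mul_le_mul ?_ hρt (by positivity) (by positivity)
          rw [div_le_iff₀ htpos]; linarith
    · have e : γ * t ^ q * (t ^ q * t ^ s / 2) ≤ γ * t ^ q * β t := by gcongr
      have e2 : γ ^ 2 * (t ^ q) ^ 2 * 1 ≤ γ ^ 2 * (t ^ q) ^ 2 * t ^ s := by gcongr
      nlinarith
    · refine g6.trans ?_
      have := mul_le_mul_of_nonneg_right (hmk t ht') (by positivity : 0 ≤ 3 * (t ^ q * t ^ s))
      linarith
    · rw [div_le_iff₀ ha] at h4
      rw [div_le_iff₀ htpos]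
      have := mul_le_mul_of_nonneg_right h4 (by positivity : 0 ≤ t ^ q * t ^ s)
      linarith
    · refine (norm_sq_add_add_le _ _ _).trans (le_of_eq ?_)
      rw [norm_smul, norm_smul, norm_smul, mul_pow, mul_pow, mul_pow, Real.norm_eq_abs,
        Real.norm_eq_abs, Real.norm_eq_abs, sq_abs, sq_abs, sq_abs]
    · have := sq_perturbation_le (r₁ := r₁) (r₂ := r₂) hQ hS (hmpos t ht') hγ (hmγ t ht')
        (hmk t ht') hδ0 g6
      rw [mul_pow]
      refine (mul_le_mul_of_nonneg_right this (sq_nonneg t⁻¹)).trans (le_of_eq ?_)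
      simp only [hρdef, hWdef, hCdef]
      field_simp
  choose! E' hE' hE'le using hderiv
  have hWd : ∀ t ≥ T, HasDerivAt W
      (m' t * (t ^ q) ^ 2 * (t ^ p) ^ 2 / t ^ 2 + 2 * (q + p - 1) * (W t / t)) t := by
    intro t ht
    have htpos : 0 < t := ht₀.trans (hT t ht).1
    refine ((((hmd t (hT t ht).1.le).mul ((hasDerivAt_rpow_mul_div htpos q).pow 2)).mul
      ((hasDerivAt_rpow_mul_div htpos p).pow 2)).div ((hasDerivAt_id t).pow 2)
      (by simp [htpos.ne'])).congr_deriv ?_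
    simp only [hWdef, Pi.mul_apply, Pi.pow_apply, id]
    field_simp
    ring
  have hWpos : ∀ t ≥ T, 0 < W t := by
    intro t ht
    have htpos : 0 < t := ht₀.trans (hT t ht).1
    have := hmpos t (hT t ht).1.le
    positivity
  obtain ⟨M, hM, hEM⟩ := exists_forall_le_mul_of_deriv_le (C' := k₂ + 2) (ρ := ρ) hK
    (by positivity : 0 ≤ 3 * C / (2 * k)) hE' hWd hWpos
    (fun t ht => by have : 0 < t := ht₀.trans (hT t ht).1
                    positivity)
    hE'le
    (fun t ht => by
      have htpos : 0 < t := ht₀.trans (hT t ht).1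
      have h := hm1 t (hT t ht).1.le
      have h' : -(k₂ * m t) ≤ t * m' t := by
        have := mul_le_mul_of_nonneg_left (neg_abs_le (m' t)) htpos.le
        linarith
      have e1 : -(k₂ / t * W t) ≤ m' t * (t ^ q) ^ 2 * (t ^ p) ^ 2 / t ^ 2 := by
        have := mul_le_mul_of_nonneg_right h'
          (by positivity : 0 ≤ (t ^ q) ^ 2 * (t ^ p) ^ 2 / t ^ 3)
        refine le_trans (le_of_eq ?_) (this.trans (le_of_eq ?_))
        · simp only [hWdef]; field_simp
        · field_simp
      have e2 : 0 ≤ (q + p) * (W t / t) := by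
        have := hWpos t ht
        positivity
      have e3 : (k₂ + 2) / t * W t = k₂ / t * W t + 2 * (W t / t) := by ring
      linarith)
    (fun t ht => by
      obtain ⟨h0, h1, -, -, -, -, h6⟩ := hT t ht
      have htpos : 0 < t := by linarith
      have hPt : t ^ p ≤ t := by simpa using Real.rpow_le_rpow_of_exponent_le h1 hp1.le
      have hQρ : t ^ q / t ≤ ρ t := by
        simp only [hρdef]
        exact div_le_div₀ (by positivity)
          (le_mul_of_one_le_right (by positivity) (Real.one_le_rpow h1 hs.le)) (by positivity) hPt
      rw [div_le_iff₀ hK] at h6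
      calc (k₂ + 2) / t ≤ K / 2 * (t ^ q) / t := by
            apply div_le_div_of_nonneg_right _ htpos.le; linarith
        _ = K / 2 * (t ^ q / t) := by ring
        _ ≤ K / 2 * ρ t := by gcongr)
  refine ⟨max (2 * M + 4 * M / a) (2 * M / γ), by positivity, ?_⟩
  filter_upwards [eventually_ge_atTop T] with t ht
  obtain ⟨g1, g2, g3⟩ := hcoef t ht
  have hE := hEM t ht
  have hW := hWpos t ht
  have hH := hH0 t ht
  have hδH : γ / 2 * H t ≤ δ t * H t := mul_le_mul_of_nonneg_right g3 hH
  have hκU : 1 / 2 * ‖x t - y t‖ ^ 2 ≤ κ t * ‖x t - y t‖ ^ 2 := by gcongr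
  have hκU' := mul_le_mul_of_nonneg_left hκU (by positivity : 0 ≤ a / 2)
  have hv := sq_nonneg ‖a • (x t - y t) + μ t • x' t + (γ * t ^ q) • G t‖
  have hw := sq_nonneg ‖lam t - l t‖
  have hu : 0 ≤ a / 4 * ‖x t - y t‖ ^ 2 := by positivity
  have hh : 0 ≤ γ / 2 * H t := by positivity
  simp only [hEdef] at hE
  constructor
  · refine le_trans ?_ (mul_le_mul_of_nonneg_right (le_max_left _ _) hW.le)
    have e1 : ‖lam t - l t‖ ^ 2 ≤ 2 * M * W t := by linarith
    have e2 : ‖x t - y t‖ ^ 2 ≤ 4 * M / a * W t := by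
      rw [div_mul_eq_mul_div, le_div_iff₀ ha]; linarith
    linarith
  · refine le_trans ?_ (mul_le_mul_of_nonneg_right (le_max_right _ _) hW.le)
    change H t ≤ 2 * M / γ * W t
    rw [div_mul_eq_mul_div, le_div_iff₀ hγ]
    linarith

/-- Primal rates in terms of the distance to the saddle point `(y, l)` of the `ε`-regularized
Lagrangian and of the regularized Lagrangian gap. -/
lemma primal_rates_of_dist_regularized_saddle {X Y : Type*} [NormedAddCommGroup X]
    [InnerProductSpace ℝ X] [CompleteSpace X] [NormedAddCommGroup Y] [InnerProductSpace ℝ Y]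
    [CompleteSpace Y] {f : X → ℝ} {f' : X → X} {A : X →L[ℝ] Y} {b : Y}
    (hf : ∀ u, HasGradientAt f (f' u) u) (hconv : ConvexOn ℝ Set.univ f) {xs : X} {ls : Y}
    (hfeas : A xs = b) (hmin : ∀ u, f xs ≤ f u + ⟪ls, A u - b⟫) {ε : ℝ} (hε : 0 < ε)
    {x y : X} {l : Y} (hy : f' y + ContinuousLinearMap.adjoint A l + ε • y = 0)
    (hl : A y - b - ε • l = 0) {R r N : ℝ} (hR : 0 ≤ R) (hRsq : ‖xs‖ ^ 2 + ‖ls‖ ^ 2 = R ^ 2)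
    (hr : ‖x - y‖ ≤ r)
    (hN : f x - f y + ⟪l, A (x - y)⟫ + ε / 2 * (‖x‖ ^ 2 - ‖y‖ ^ 2) ≤ N) :
    ‖A x - b‖ ≤ ‖A‖ * r + ε * R ∧
      |f x - f xs| ≤ |N| + (‖A‖ + ε) * R * r + ε * (2 * R ^ 2) := by
  obtain ⟨h1, h2⟩ := regularized_saddle_bounds hf hconv hfeas hmin hε hy hl
  rw [hRsq] at h1 h2
  have hyR : ‖y‖ ≤ R := (abs_le_of_sq_le_sq' (by
    linarith [sq_nonneg ‖l‖] : ‖y‖ ^ 2 ≤ R ^ 2) hR).2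
  have hlR : ‖l‖ ≤ R := (abs_le_of_sq_le_sq' (by
    linarith [sq_nonneg ‖y‖] : ‖l‖ ^ 2 ≤ R ^ 2) hR).2
  have hr0 : 0 ≤ r := (norm_nonneg _).trans hr
  have hAu : ‖A (x - y)‖ ≤ ‖A‖ * r := (A.le_opNorm _).trans (by gcongr)
  constructor
  · have e : A x - b = A (x - y) + ε • l := by
      rw [map_sub, ← sub_eq_zero.mp hl]; abel
    rw [e]
    refine (norm_add_le _ _).trans (add_le_add hAu ?_)
    rw [norm_smul, Real.norm_eq_abs, abs_of_pos hε]
    gcongr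
  have i1 : |⟪l, A (x - y)⟫| ≤ R * (‖A‖ * r) :=
    (abs_real_inner_le_norm _ _).trans (by gcongr)
  have i2 : |⟪y, x - y⟫| ≤ R * r := (abs_real_inner_le_norm _ _).trans (by gcongr)
  have e : ‖x‖ ^ 2 = ‖y‖ ^ 2 + 2 * ⟪y, x - y⟫ + ‖x - y‖ ^ 2 := by
    rw [← norm_add_sq_real, add_sub_cancel]
  have hgrad := hconv.add_inner_gradient_le (hf y) x
  have hgy : f' y = -ContinuousLinearMap.adjoint A l - ε • y := by
    rw [eq_sub_iff_add_eq, eq_neg_iff_add_eq_zero, ← hy]; abel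
  rw [hgy, inner_sub_left, inner_neg_left, ContinuousLinearMap.adjoint_inner_left,
    real_inner_smul_left] at hgrad
  rw [e] at hN
  have j1 := mul_le_mul_of_nonneg_left (abs_le.mp i2).1 hε.le
  have j2 := mul_le_mul_of_nonneg_left (abs_le.mp i2).2 hε.le
  have j3 : 0 ≤ ε / 2 * ‖x - y‖ ^ 2 := by positivity
  obtain ⟨k1, k2⟩ := abs_le.mp i1
  obtain ⟨l1, l2⟩ := abs_le.mp h2
  have n1 := le_abs_self N
  have n2 := abs_nonneg N
  rw [abs_le]
  constructor <;> linarith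

/-- Saddle points of the Lagrangian are feasible and minimize it in the primal variable. -/
lemma feasible_of_saddle {X Y : Type*} [NormedAddCommGroup X] [InnerProductSpace ℝ X]
    [NormedAddCommGroup Y] [InnerProductSpace ℝ Y] {f : X → ℝ} {A : X →L[ℝ] Y} {b : Y} {xs : X}
    {ls : Y} (h : ∀ (u : X) (ν : Y), f xs + ⟪ν, A xs - b⟫ ≤ f xs + ⟪ls, A xs - b⟫ ∧
      f xs + ⟪ls, A xs - b⟫ ≤ f u + ⟪ls, A u - b⟫) :
    A xs = b ∧ ∀ u, f xs ≤ f u + ⟪ls, A u - b⟫ := by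
  have hfeas : A xs - b = 0 := by
    have := (h xs (ls + (A xs - b))).1
    rw [inner_add_left, real_inner_self_eq_norm_sq] at this
    have h0 : ‖A xs - b‖ ^ 2 ≤ 0 := by linarith
    exact norm_eq_zero.mp (pow_eq_zero_iff two_ne_zero |>.mp (le_antisymm h0 (sq_nonneg _)))
  refine ⟨sub_eq_zero.mp hfeas, fun u => ?_⟩
  simpa [hfeas] using (h u ls).2

set_option maxHeartbeats 1000000 in
theorem rates_large_p_subcase_two
    {X Y : Type*} [NormedAddCommGroup X] [InnerProductSpace ℝ X] [CompleteSpace X]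
    [NormedAddCommGroup Y] [InnerProductSpace ℝ Y] [CompleteSpace Y]
    (f : X → ℝ) (f' : X → X) (hf : ∀ u, HasGradientAt f (f' u) u)
    (hconv : ConvexOn ℝ Set.univ f)
    (A : X →L[ℝ] Y) (b : Y)
    (L : X → Y → ℝ) (hL : ∀ u lam, L u lam = f u + ⟪lam, A u - b⟫)
    (c p t₀ : ℝ) (hc : 0 < c) (hp0 : 0 < p) (hp1 : p < 1) (ht₀ : 0 < t₀)
    (Lt : ℝ → X → Y → ℝ)
    (hLt : ∀ t u lam, Lt t u lam = L u lam + (c / (2 * t ^ p)) * (‖u‖ ^ 2 - ‖lam‖ ^ 2))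
    (gx : ℝ → X → Y → X)
    (hgx : ∀ t u lam, gx t u lam = f' u + ContinuousLinearMap.adjoint A lam + (c / t ^ p) • u)
    (gl : ℝ → X → Y → Y)
    (hgl : ∀ t u lam, gl t u lam = A u - b - (c / t ^ p) • lam)
    (Om : Set (X × Y))
    (hOm : Om = {z : X × Y | ∀ u μ, L z.1 μ ≤ L z.1 z.2 ∧ L z.1 z.2 ≤ L u z.2})
    (hOmne : Om.Nonempty)
    (xs : X) (ls : Y)
    (hmem : (xs, ls) ∈ Om)
    (hmin : ∀ w ∈ Om, Real.sqrt (‖xs‖ ^ 2 + ‖ls‖ ^ 2) ≤ Real.sqrt (‖w.1‖ ^ 2 + ‖w.2‖ ^ 2))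
    (α q γ s : ℝ) (hα : 1 < α) (hq0 : 0 < q) (hq1 : q < 1) (hγ : 0 < γ) (hs : 0 < s)
    (m m' m'' : ℝ → ℝ)
    (hmpos : ∀ t ≥ t₀, 0 < m t)
    (hmmono : AntitoneOn m (Set.Ici t₀))
    (hmd : ∀ t ≥ t₀, HasDerivAt m (m' t) t)
    (hmd2 : ∀ t ≥ t₀, HasDerivAt m' (m'' t) t)
    (θ : ℝ → ℝ)
    (hθ : ∀ t, θ t = (m t * t ^ (2*q+s) + γ * t ^ q - 2 * m t * γ * q * t ^ (2*q-1)
      - γ * m' t * t ^ (2*q)) / ((α - 1) * (t ^ (q+s) - γ * q * t ^ (q-1))))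
    (k₁ k₂ T₁ T₂ : ℝ) (hk₁ : 0 < k₁) (hk₂ : 0 < k₂) (hT₁ : t₀ ≤ T₁) (hT₂ : t₀ ≤ T₂)
    (hA1 : ∀ t ≥ T₁, γ / t ^ (q+s) ≤ m t ∧ m t ≤ k₁ / t ^ q)
    (hA2 : ∀ t ≥ T₂, t * |m' t| ≤ k₂ * m t ∧ t ^ 2 * |m'' t| ≤ k₂ * m t)
    (x : ℝ → X) (lam : ℝ → Y) (x' x'' : ℝ → X) (lam' : ℝ → Y) (gder : ℝ → X)
    (hx : ∀ t ≥ t₀, HasDerivAt x (x' t) t)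
    (hx' : ∀ t ≥ t₀, HasDerivAt x' (x'' t) t)
    (hx''c : ContinuousOn x'' (Set.Ici t₀))
    (hlam : ∀ t ≥ t₀, HasDerivAt lam (lam' t) t)
    (hlamc : ContinuousOn lam' (Set.Ici t₀))
    (hgder : ∀ t ≥ t₀, HasDerivAt (fun τ => gx τ (x τ) (lam τ)) (gder t) t)
    (hode1 : ∀ t ≥ t₀, m t • x'' t + (α / t ^ q) • x' t + γ • gder t
      + t ^ s • gx t (x t) (lam t) = 0)
    (hode2 : ∀ t ≥ t₀, lam' t = ((α - 1) * (t ^ (q+s) - γ * q * t ^ (q-1)))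
      • gl t (x t + θ t • x' t) (lam t))
    (xt : ℝ → X) (lt : ℝ → Y)
    (hsaddle : ∀ t ≥ t₀, gx t (xt t) (lt t) = 0 ∧ gl t (xt t) (lt t) = 0)
    (xt' : ℝ → X) (lt' : ℝ → Y)
    (hxt : ∀ t ≥ t₀, HasDerivAt xt (xt' t) t)
    (hlt : ∀ t ≥ t₀, HasDerivAt lt (lt' t) t)
    (hxtc : ContinuousOn xt' (Set.Ici t₀))
    (hltc : ContinuousOn lt' (Set.Ici t₀))
    (hqs1 : (1 - q)/2 ≤ 2*q + s) (hqs2 : 2*q + s < 1 - q)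
    (hcond1 : 4*q + s + p - 2 < 0) (hp2 : 2*q + s ≤ p) (hp3 : p < 1 - q)
    :
    ((fun t => L (x t) ls - L xs ls) =O[atTop]
        (fun t => Real.sqrt (m t) * t ^ (q+p-1) + t ^ (-p)))
    ∧ ((fun t => |f (x t) - f xs|) =O[atTop]
        (fun t => Real.sqrt (m t) * t ^ (q+p-1) + t ^ (-p)))
    ∧ ((fun t => ‖A (x t) - b‖) =O[atTop]
        (fun t => Real.sqrt (m t) * t ^ (q+p-1) + t ^ (-p)))
    ∧ ((fun t => ‖x t - xt t‖ ^ 2 + ‖lam t - lt t‖ ^ 2) =O[atTop]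
        (fun t => m t * t ^ (2*q+2*p-2))) := by
  set a := α - 1 with ha_def
  have ha : 0 < a := sub_pos.mpr hα
  set R := Real.sqrt (‖xs‖ ^ 2 + ‖ls‖ ^ 2) with hRdef
  have hRsq : ‖xs‖ ^ 2 + ‖ls‖ ^ 2 = R ^ 2 := (Real.sq_sqrt (by positivity)).symm
  have hR : 0 ≤ R := Real.sqrt_nonneg _
  obtain ⟨hfeas, hmin'⟩ : A xs = b ∧ ∀ u, f xs ≤ f u + ⟪ls, A u - b⟫ := by
    apply feasible_of_saddle
    intro u ν
    rw [hOm] at hmem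
    simpa only [hL] using hmem u ν
  set τ := max (max T₁ T₂) (max 1 (2 * γ)) with hτdef
  have hτ : ∀ t ≥ τ, T₁ ≤ t ∧ T₂ ≤ t ∧ t₀ ≤ t ∧ 1 ≤ t ∧ 2 * γ ≤ t := by
    intro t ht
    have h1 : T₁ ≤ t := (le_max_left _ _).trans ((le_max_left _ _).trans ht)
    exact ⟨h1, (le_max_right _ _).trans ((le_max_left _ _).trans ht), hT₁.trans h1,
      (le_max_left _ _).trans ((le_max_right _ _).trans ht),
      (le_max_right _ _).trans ((le_max_right _ _).trans ht)⟩
  have hsy : ∀ t ≥ t₀, f' (xt t) + ContinuousLinearMap.adjoint A (lt t) + (c / t ^ p) • xt t = 0 :=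
    fun t ht => by rw [← hgx]; exact (hsaddle t ht).1
  have hsl : ∀ t ≥ t₀, A (xt t) - b - (c / t ^ p) • lt t = 0 :=
    fun t ht => by rw [← hgl]; exact (hsaddle t ht).2
  have hε : ∀ t ≥ t₀, 0 < c / t ^ p :=
    fun t ht => div_pos hc (Real.rpow_pos_of_pos (ht₀.trans_le ht) p)
  have hmk : ∀ t ≥ τ, m t * t ^ q ≤ k₁ := fun t ht => by
    obtain ⟨h1, -, h0, -⟩ := hτ t ht
    rw [← le_div_iff₀ (Real.rpow_pos_of_pos (ht₀.trans_le h0) q)]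
    exact (hA1 t h1).2
  obtain ⟨M, hM, hdecay⟩ := energy_decay (t₀ := τ) (R := R) (a := a) (k₁ := k₁) (k₂ := k₂)
    (G := fun t => gx t (x t) (lam t)) (b := b) (f := f) (c := c) (s := s) (γ := γ) (m := m)
    (lam := lam) (y := xt) (l := lt) (x := x)
    hf hconv hc hp0 hp1 hq0 hq1 hs hγ ha hk₁ hk₂ (by positivity) hR (by linarith)
    (fun t ht => hmpos t (hτ t ht).2.2.1) (fun t ht => hmd t (hτ t ht).2.2.1)
    (fun t ht => hmd2 t (hτ t ht).2.2.1)
    (fun t ht => by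
      obtain ⟨h1, -, h0, -⟩ := hτ t ht
      have htpos := ht₀.trans_le h0
      rw [← Real.rpow_add htpos, ← div_le_iff₀ (Real.rpow_pos_of_pos htpos _)]
      exact (hA1 t h1).1)
    hmk
    (fun t ht => (hA2 t (hτ t ht).2.1).1) (fun t ht => (hA2 t (hτ t ht).2.1).2)
    (fun _ => rfl) (fun _ => rfl) (fun _ => rfl) (fun _ => rfl)
    (fun t ht => hx t (hτ t ht).2.2.1) (fun t ht => hx' t (hτ t ht).2.2.1)
    (fun t ht => hlam t (hτ t ht).2.2.1) (fun t ht => hgder t (hτ t ht).2.2.1)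
    (fun t _ => hgx _ _ _)
    (fun t ht => by
      have h0 := (hτ t ht).2.2.1
      have hQ : 0 < t ^ q := Real.rpow_pos_of_pos (ht₀.trans_le h0) q
      have h := congrArg (fun v => t ^ q • v) (hode1 t h0)
      simp only [smul_add, smul_smul, smul_zero] at h
      rw [← h]
      have e : t ^ q * (α / t ^ q) = a + 1 := by rw [ha_def]; field_simp; ring
      rw [e, mul_comm (t ^ q) (m t), mul_comm (t ^ q) γ])
    (fun t ht => by
      obtain ⟨-, -, h0, h1, h2⟩ := hτ t ht
      have htpos := ht₀.trans_le h0
      have hQ : 0 < t ^ q := Real.rpow_pos_of_pos htpos q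
      have hS : 1 ≤ t ^ s := Real.one_le_rpow h1 hs.le
      have e1 : t ^ (q - 1) = t ^ q / t := Real.rpow_sub_one htpos.ne' q
      have e2 : t ^ (2 * q) = t ^ q * t ^ q := by rw [two_mul, Real.rpow_add htpos]
      have e3 : t ^ (2 * q - 1) = t ^ q * t ^ q / t := by rw [Real.rpow_sub_one htpos.ne', e2]
      have e4 : t ^ (2 * q + s) = t ^ q * t ^ q * t ^ s := by rw [Real.rpow_add htpos, e2]
      have e5 : t ^ (q + s) = t ^ q * t ^ s := Real.rpow_add htpos q s
      have hβ : 0 < t ^ q * t ^ s - γ * q * (t ^ q / t) := by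
        have : γ * q / t < 1 := by
          rw [div_lt_one htpos]
          nlinarith
        have e : t ^ q * t ^ s - γ * q * (t ^ q / t) = t ^ q * (t ^ s - γ * q / t) := by ring
        rw [e]
        exact mul_pos hQ (by linarith)
      rw [hode2 t h0, hgl, hθ, map_add, map_smul, e1, e2, e3, e4, e5]
      have hsplit : ∀ (r θ' : ℝ) (u v w : Y), r • (u + θ' • v - b - w) =
          r • (u - b - w) + (r * θ') • v := by
        intro r θ' u v w
        rw [mul_smul, ← smul_add]; congr 1; abel
      rw [hsplit]
      congr 2
      · ring
      · rw [mul_div_cancel₀ _ (mul_pos ha hβ).ne']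
        field_simp
        ring)
    (fun t ht => hxt t (hτ t ht).2.2.1) (fun t ht => hlt t (hτ t ht).2.2.1)
    (fun t ht => hsy t (hτ t ht).2.2.1) (fun t ht => hsl t (hτ t ht).2.2.1)
    (fun t ht => by
      have h0 := (hτ t ht).2.2.1
      rw [← hRsq]
      exact (regularized_saddle_bounds hf hconv hfeas hmin' (hε t h0) (hsy t h0) (hsl t h0)).1)
  set N : ℝ → ℝ := fun t => Real.sqrt (m t) * t ^ (q + p - 1) with hNdef
  have hNsq : ∀ t ≥ τ, m t * (t ^ q) ^ 2 * (t ^ p) ^ 2 / t ^ 2 = N t ^ 2 := by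
    intro t ht
    have h0 := (hτ t ht).2.2.1
    have htpos := ht₀.trans_le h0
    simp only [hNdef]
    rw [mul_pow, Real.sq_sqrt (hmpos t h0).le, Real.rpow_sub_one htpos.ne', Real.rpow_add htpos]
    ring
  have hN0 : ∀ t ≥ τ, 0 ≤ N t := fun t ht =>
    mul_nonneg (Real.sqrt_nonneg _) (Real.rpow_nonneg (ht₀.le.trans (hτ t ht).2.2.1) _)
  have hN1 : ∀ t ≥ τ, N t ≤ Real.sqrt k₁ := by
    intro t ht
    obtain ⟨-, -, h0, h1, -⟩ := hτ t ht
    have hQ : 1 ≤ t ^ q := Real.one_le_rpow h1 hq0.le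
    have hmk₁ : m t ≤ k₁ :=
      (le_mul_of_one_le_right (hmpos t h0).le hQ).trans (hmk t ht)
    have : t ^ (q + p - 1) ≤ 1 := Real.rpow_le_one_of_one_le_of_nonpos h1 (by linarith)
    exact (mul_le_of_le_one_right (Real.sqrt_nonneg _) this).trans (Real.sqrt_le_sqrt hmk₁)
  have hprimal : ∃ C, ∀ᶠ t in atTop, ‖A (x t) - b‖ ≤ C * (N t + t ^ (-p)) ∧
      |f (x t) - f xs| ≤ C * (N t + t ^ (-p)) := by
    refine ⟨‖A‖ * Real.sqrt M + c * R + M * Real.sqrt k₁ + (‖A‖ + c) * R * Real.sqrt M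
      + c * (2 * R ^ 2), ?_⟩
    filter_upwards [hdecay, eventually_ge_atTop τ] with t ⟨hd1, hd2⟩ ht
    obtain ⟨-, -, h0, h1, -⟩ := hτ t ht
    have htpos := ht₀.trans_le h0
    rw [hNsq t ht] at hd1 hd2
    have hN := hN0 t ht
    have hP : 0 ≤ t ^ (-p) := Real.rpow_nonneg htpos.le _
    have hεP : c / t ^ p = c * t ^ (-p) := by rw [Real.rpow_neg htpos.le, div_eq_mul_inv]
    have hεc : c / t ^ p ≤ c := div_le_self hc.le (Real.one_le_rpow h1 hp0.le)
    have hr : ‖x t - xt t‖ ≤ Real.sqrt M * N t := by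
      refine (abs_le_of_sq_le_sq' ?_ (by positivity)).2
      rw [mul_pow, Real.sq_sqrt hM.le]
      linarith [sq_nonneg ‖lam t - lt t‖]
    obtain ⟨r1, r2⟩ := primal_rates_of_dist_regularized_saddle hf hconv hfeas hmin' (hε t h0)
      (hsy t h0) (hsl t h0) hR hRsq hr hd2
    have b1 : ‖A‖ * (Real.sqrt M * N t) ≤ ‖A‖ * Real.sqrt M * (N t + t ^ (-p)) := by
      rw [← mul_assoc]; gcongr; linarith
    have b2 : c / t ^ p * R ≤ c * R * (N t + t ^ (-p)) := by
      rw [hεP, mul_right_comm]; gcongr; linarith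
    have b3 : |M * N t ^ 2| ≤ M * Real.sqrt k₁ * (N t + t ^ (-p)) := by
      rw [abs_of_nonneg (by positivity), sq, ← mul_assoc]
      exact mul_le_mul (mul_le_mul_of_nonneg_left (hN1 t ht) hM.le) (by linarith) hN
        (by positivity)
    have b4 : (‖A‖ + c / t ^ p) * R * (Real.sqrt M * N t)
        ≤ (‖A‖ + c) * R * Real.sqrt M * (N t + t ^ (-p)) := by
      rw [← mul_assoc]; gcongr; linarith
    have b5 : c / t ^ p * (2 * R ^ 2) ≤ c * (2 * R ^ 2) * (N t + t ^ (-p)) := by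
      rw [hεP, mul_right_comm]; gcongr; linarith
    have p1 : 0 ≤ ‖A‖ * Real.sqrt M * (N t + t ^ (-p)) := by positivity
    have p2 : 0 ≤ c * R * (N t + t ^ (-p)) := by positivity
    have p3 : 0 ≤ M * Real.sqrt k₁ * (N t + t ^ (-p)) := by positivity
    have p4 : 0 ≤ (‖A‖ + c) * R * Real.sqrt M * (N t + t ^ (-p)) := by positivity
    have p5 : 0 ≤ c * (2 * R ^ 2) * (N t + t ^ (-p)) := by positivity
    constructor <;> linarith
  obtain ⟨C, hC⟩ := hprimal
  have hfeasO : (fun t => ‖A (x t) - b‖) =O[atTop] (fun t => N t + t ^ (-p)) := by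
    refine IsBigO.of_bound C ?_
    filter_upwards [hC, eventually_ge_atTop τ] with t ⟨h, _⟩ ht
    rw [norm_norm, Real.norm_of_nonneg
      (add_nonneg (hN0 t ht) (Real.rpow_nonneg (ht₀.le.trans (hτ t ht).2.2.1) _))]
    exact h
  have hvalO : (fun t => |f (x t) - f xs|) =O[atTop] (fun t => N t + t ^ (-p)) := by
    refine IsBigO.of_bound C ?_
    filter_upwards [hC, eventually_ge_atTop τ] with t ⟨_, h⟩ ht
    rw [Real.norm_eq_abs, abs_abs, Real.norm_of_nonneg
      (add_nonneg (hN0 t ht) (Real.rpow_nonneg (ht₀.le.trans (hτ t ht).2.2.1) _))]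
    exact h
  refine ⟨?_, hvalO, hfeasO, ?_⟩
  · have hinner : (fun t => ⟪ls, A (x t) - b⟫) =O[atTop] (fun t => N t + t ^ (-p)) :=
      (IsBigO.of_bound ‖ls‖ (Eventually.of_forall fun t => by
        rw [norm_norm]; exact norm_inner_le_norm _ _)).trans hfeasO
    refine (((isBigO_abs_left.mp hvalO).add hinner).congr_left fun t => ?_)
    rw [hL, hL, hfeas, sub_self, inner_zero_right]
    ring
  · refine IsBigO.of_bound M ?_
    filter_upwards [hdecay, eventually_ge_atTop τ] with t ⟨hd, _⟩ ht
    have h0 := (hτ t ht).2.2.1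
    have htpos := ht₀.trans_le h0
    have e : t ^ (2 * q + 2 * p - 2) = (t ^ q) ^ 2 * (t ^ p) ^ 2 / t ^ 2 := by
      rw [Real.rpow_sub htpos, Real.rpow_add htpos, two_mul, two_mul, Real.rpow_add htpos,
        Real.rpow_add htpos, Real.rpow_two]
      ring
    rw [Real.norm_of_nonneg (by positivity), e, Real.norm_of_nonneg
      (by have := hmpos t h0; positivity)]
    refine hd.trans (le_of_eq ?_)
    ring
end
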